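/- Let 𝒜 = H_0 + 𝒜_0 be a real affine space of self-adjoint operators on a Hilbert space ℋ over a real normed vector space 𝒜_0 of bounded self-adjoint perturbations, such that any two operators from 𝒜 are resolvent comparable and the norm ‖·‖_F of 𝒜_0 satisfies ‖V‖_F ≥ c‖R_z(H) V R_z(H)‖_1 for some constant c > 0, some H ∈ 𝒜 and some nonreal z. Then for any H_0, H_1 ∈ 𝒜, the spectral shift measure ξ(·; H_1, H_0) is absolutely continuous with respect to Lebesgue measure on ℝ. -/

import Mathlib

open MeasureTheory Filter Complex Set Topology
open scoped InnerProductSpace ComplexInnerProductSpace ENNReal Topology Real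
set_option autoImplicit false

noncomputable section

namespace SSF

variable {𝓗 : Type*} {𝓚 : Type*}

section TraceClass

variable [NormedAddCommGroup 𝓗] [InnerProductSpace ℂ 𝓗]
variable [NormedAddCommGroup 𝓚] [InnerProductSpace ℂ 𝓚]

/-- A bounded operator `T` on a Hilbert space is trace class iff the sums
`∑ |⟪e i, T (f i)⟫|` over finite orthonormal families `e,f` are uniformly bounded. -/
def IsTraceClass (T : 𝓗 →L[ℂ] 𝓗) : Prop :=
  ∃ C : ℝ, ∀ (n : ℕ) (e f : Fin n → 𝓗), Orthonormal ℂ e → Orthonormal ℂ f →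
    ∑ i, ‖⟪e i, T (f i)⟫_ℂ‖ ≤ C

/-- The trace norm of a bounded operator: the supremum of `∑ |⟪e i, T (f i)⟫|` over
finite orthonormal families `e,f`. -/
def traceNorm (T : 𝓗 →L[ℂ] 𝓗) : ℝ :=
  sSup {c : ℝ | ∃ (n : ℕ) (e f : Fin n → 𝓗), Orthonormal ℂ e ∧ Orthonormal ℂ f ∧
    c = ∑ i, ‖⟪e i, T (f i)⟫_ℂ‖}

/-- The trace of a bounded operator, computed in a Hilbert basis (meaningful for
trace class operators). -/
def trace [CompleteSpace 𝓗] (T : 𝓗 →L[ℂ] 𝓗) : ℂ :=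
  ∑' i : (exists_hilbertBasis ℂ 𝓗).choose, ⟪(i : 𝓗), T (i : 𝓗)⟫_ℂ

/-- A bounded operator between Hilbert spaces is Hilbert-Schmidt iff the sums
`∑ ‖T (e i)‖ ^ 2` over finite orthonormal families are uniformly bounded. -/
def IsHilbertSchmidt (T : 𝓗 →L[ℂ] 𝓚) : Prop :=
  ∃ C : ℝ, ∀ (n : ℕ) (e : Fin n → 𝓗), Orthonormal ℂ e → ∑ i, ‖T (e i)‖ ^ 2 ≤ C

end TraceClass

variable [NormedAddCommGroup 𝓗] [InnerProductSpace ℂ 𝓗] [CompleteSpace 𝓗]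
variable [NormedAddCommGroup 𝓚] [InnerProductSpace ℂ 𝓚] [CompleteSpace 𝓚]

/-- A (possibly unbounded) self-adjoint operator on a Hilbert space, bundled together
with its resolvent `R_z = (H - z)⁻¹` at every nonreal `z`. -/
structure SelfAdjointOperator (𝓗 : Type*) [NormedAddCommGroup 𝓗]
    [InnerProductSpace ℂ 𝓗] [CompleteSpace 𝓗] where
  domain : Submodule ℂ 𝓗
  dense_domain : Dense (domain : Set 𝓗)
  op : domain →ₗ[ℂ] 𝓗
  symmetric : ∀ f g : domain, ⟪op f, (g : 𝓗)⟫_ℂ = ⟪(f : 𝓗), op g⟫_ℂ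
  resolvent : ℂ → (𝓗 →L[ℂ] 𝓗)
  resolvent_mem : ∀ z : ℂ, z.im ≠ 0 → ∀ f : 𝓗, resolvent z f ∈ domain
  resolvent_right : ∀ (z : ℂ) (hz : z.im ≠ 0) (f : 𝓗),
    op ⟨resolvent z f, resolvent_mem z hz f⟩ - z • resolvent z f = f
  resolvent_left : ∀ (z : ℂ), z.im ≠ 0 → ∀ g : domain,
    resolvent z (op g - z • (g : 𝓗)) = (g : 𝓗)

/-- `IsSum H0 V H1` encodes the relation `H1 = H0 + V` for a bounded perturbation `V`,
via the second resolvent identity (which characterises it uniquely). -/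
def IsSum (H0 : SelfAdjointOperator 𝓗) (V : 𝓗 →L[ℂ] 𝓗)
    (H1 : SelfAdjointOperator 𝓗) : Prop :=
  ∀ z : ℂ, z.im ≠ 0 →
    H1.resolvent z - H0.resolvent z = -(H1.resolvent z ∘L (V ∘L H0.resolvent z))

/-- Two self-adjoint operators are resolvent comparable if the difference of their
resolvents at some (hence any) nonreal point is trace class. -/
def ResolventComparable (H0 H1 : SelfAdjointOperator 𝓗) : Prop :=
  ∃ z : ℂ, z.im ≠ 0 ∧ IsTraceClass (H1.resolvent z - H0.resolvent z)

/-- The spectral measure of a self-adjoint operator `H`, bundled with the associated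
scalar spectral measures, the Borel functional calculus, and the decomposition into
absolutely continuous and singular parts. -/
structure SpectralMeasure (H : SelfAdjointOperator 𝓗) where
  proj : Set ℝ → (𝓗 →L[ℂ] 𝓗)
  proj_sa : ∀ s, IsSelfAdjoint (proj s)
  proj_mul : ∀ s t, proj (s ∩ t) = proj s ∘L proj t
  proj_univ : proj Set.univ = 1
  scalar : 𝓗 → Measure ℝ
  scalar_finite : ∀ f, IsFiniteMeasure (scalar f)
  scalar_spec : ∀ (f : 𝓗) (s : Set ℝ), MeasurableSet s →
    (scalar f s).toReal = (⟪f, proj s f⟫_ℂ).re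
  resolvent_spec : ∀ (z : ℂ), z.im ≠ 0 → ∀ f : 𝓗,
    ⟪f, H.resolvent z f⟫_ℂ = ∫ x : ℝ, ((x : ℂ) - z)⁻¹ ∂(scalar f)
  fc : (ℝ → ℂ) → (𝓗 →L[ℂ] 𝓗)
  fc_spec : ∀ (φ : ℝ → ℂ), Measurable φ → (∃ C, ∀ x, ‖φ x‖ ≤ C) →
    ∀ f : 𝓗, ⟪f, fc φ f⟫_ℂ = ∫ x : ℝ, φ x ∂(scalar f)
  acProj : Set ℝ → (𝓗 →L[ℂ] 𝓗)
  sProj : Set ℝ → (𝓗 →L[ℂ] 𝓗)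
  acProj_add_sProj : ∀ s, acProj s + sProj s = proj s
  acScalar : 𝓗 → Measure ℝ
  sScalar : 𝓗 → Measure ℝ
  acScalar_spec : ∀ (f : 𝓗) (s : Set ℝ), MeasurableSet s →
    (acScalar f s).toReal = (⟪f, acProj s f⟫_ℂ).re
  sScalar_spec : ∀ (f : 𝓗) (s : Set ℝ), MeasurableSet s →
    (sScalar f s).toReal = (⟪f, sProj s f⟫_ℂ).re
  acScalar_ac : ∀ f, acScalar f ≪ MeasureTheory.volume
  sScalar_sing : ∀ f, (sScalar f).MutuallySingular MeasureTheory.volume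

/-- The real-valued test function version of the functional calculus. -/
def SpectralMeasure.fcR {H : SelfAdjointOperator 𝓗} (E : SpectralMeasure H)
    (φ : ℝ → ℝ) : 𝓗 →L[ℂ] 𝓗 :=
  E.fc fun x => (φ x : ℂ)


/-- `γ` has derivative `dγ r` at `r`, with respect to the norm function `nF`. -/
def HasPathDerivAt (nF : (𝓗 →L[ℂ] 𝓗) → ℝ) (γ dγ : ℝ → (𝓗 →L[ℂ] 𝓗)) (r : ℝ) : Prop :=
  Tendsto (fun h : ℝ => nF ((((h : ℂ))⁻¹) • (γ (r + h) - γ r) - dγ r))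
    (𝓝[≠] (0 : ℝ)) (𝓝 0)

/-- `γ` is a `C¹` path with derivative `dγ`, with respect to the norm function `nF`. -/
def IsC1Path (nF : (𝓗 →L[ℂ] 𝓗) → ℝ) (γ dγ : ℝ → (𝓗 →L[ℂ] 𝓗)) : Prop :=
  (∀ r : ℝ, HasPathDerivAt nF γ dγ r) ∧
  (∀ r : ℝ, Tendsto (fun s : ℝ => nF (dγ s - dγ r)) (𝓝 r) (𝓝 0))

/-- `γ` is a piecewise `C¹` path with derivative `dγ` (off a finite set),
with respect to the norm function `nF`. -/
def IsPiecewiseC1Path (nF : (𝓗 →L[ℂ] 𝓗) → ℝ) (γ dγ : ℝ → (𝓗 →L[ℂ] 𝓗)) : Prop :=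
  (∀ r : ℝ, Tendsto (fun s : ℝ => nF (γ s - γ r)) (𝓝 r) (𝓝 0)) ∧
  ∃ P : Finset ℝ, ∀ r ∉ P, HasPathDerivAt nF γ dγ r

/-- The setting of Section 2: a real affine space `𝒜 = H₀ + 𝒜₀` of self-adjoint
operators, over a real normed vector space `𝒜₀` of bounded self-adjoint perturbations,
such that any two operators of `𝒜` are resolvent comparable and the norm `nF` of `𝒜₀`
dominates `V ↦ ‖R_z(H) V R_z(H)‖₁`.  The affine space is realised by the map
`opOf : V ↦ H₀ + V` (with `H₀ = opOf 0`), encoded via the second resolvent identity. -/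
structure AffineSetting (𝓗 : Type*) [NormedAddCommGroup 𝓗] [InnerProductSpace ℂ 𝓗]
    [CompleteSpace 𝓗] where
  A0 : Set (𝓗 →L[ℂ] 𝓗)
  zero_mem : 0 ∈ A0
  add_mem : ∀ {V W}, V ∈ A0 → W ∈ A0 → V + W ∈ A0
  neg_mem : ∀ {V}, V ∈ A0 → -V ∈ A0
  smul_mem : ∀ (a : ℝ) {V}, V ∈ A0 → (a : ℂ) • V ∈ A0
  sa_mem : ∀ V ∈ A0, IsSelfAdjoint V
  nF : (𝓗 →L[ℂ] 𝓗) → ℝ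
  nF_nonneg : ∀ V, 0 ≤ nF V
  nF_eq_zero : ∀ V ∈ A0, (nF V = 0 ↔ V = 0)
  nF_smul : ∀ (a : ℝ) (V), nF ((a : ℂ) • V) = |a| * nF V
  nF_add : ∀ V W, nF (V + W) ≤ nF V + nF W
  opOf : (𝓗 →L[ℂ] 𝓗) → SelfAdjointOperator 𝓗
  opOf_spec : ∀ V ∈ A0, IsSum (opOf 0) V (opOf V)
  comparable : ∀ V ∈ A0, ∀ W ∈ A0, ResolventComparable (opOf V) (opOf W)
  nF_dominates : ∃ c : ℝ, 0 < c ∧ ∃ V₀ ∈ A0, ∃ z : ℂ, z.im ≠ 0 ∧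
    ∀ V ∈ A0, c * traceNorm ((opOf V₀).resolvent z ∘L (V ∘L (opOf V₀).resolvent z)) ≤ nF V

/-- The infinitesimal spectral shift measure
`Φ_H(V)(φ) = Tr(E_H(supp φ) V φ(H))`, as a real number. -/
def PhiMeas {H : SelfAdjointOperator 𝓗} (E : SpectralMeasure H)
    (V : 𝓗 →L[ℂ] 𝓗) (φ : ℝ → ℝ) : ℝ :=
  (trace (E.proj (tsupport φ) ∘L (V ∘L E.fcR φ))).re

/-- The absolutely continuous part of the infinitesimal spectral shift measure,
`Φ^{(a)}_H(V)(φ) = Tr(E^{(a)}_H(supp φ) V φ(H))`. -/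
def PhiMeasAC {H : SelfAdjointOperator 𝓗} (E : SpectralMeasure H)
    (V : 𝓗 →L[ℂ] 𝓗) (φ : ℝ → ℝ) : ℝ :=
  (trace (E.acProj (tsupport φ) ∘L (V ∘L E.fcR φ))).re

/-- The singular part of the infinitesimal spectral shift measure,
`Φ^{(s)}_H(V)(φ) = Tr(E^{(s)}_H(supp φ) V φ(H))`. -/
def PhiMeasS {H : SelfAdjointOperator 𝓗} (E : SpectralMeasure H)
    (V : 𝓗 →L[ℂ] 𝓗) (φ : ℝ → ℝ) : ℝ :=
  (trace (E.sProj (tsupport φ) ∘L (V ∘L E.fcR φ))).re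

set_option linter.unusedSectionVars false

/-- Bounded Borel functions on the real line. -/
structure BddMeas (φ : ℝ → ℂ) : Prop where
  meas : Measurable φ
  bdd : ∃ C, ∀ x, ‖φ x‖ ≤ C

namespace BddMeas

variable {φ ψ : ℝ → ℂ}

lemma of_continuous {C : ℝ} (hφ : Continuous φ) (hC : ∀ x, ‖φ x‖ ≤ C) : BddMeas φ :=
  ⟨hφ.measurable, C, hC⟩

lemma add (hφ : BddMeas φ) (hψ : BddMeas ψ) : BddMeas (fun x => φ x + ψ x) := by
  obtain ⟨C, hC⟩ := hφ.bdd
  obtain ⟨D, hD⟩ := hψ.bdd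
  exact ⟨hφ.meas.add hψ.meas, C + D, fun x => (norm_add_le _ _).trans (add_le_add (hC x) (hD x))⟩

lemma mul (hφ : BddMeas φ) (hψ : BddMeas ψ) : BddMeas (fun x => φ x * ψ x) := by
  obtain ⟨C, hC⟩ := hφ.bdd
  obtain ⟨D, hD⟩ := hψ.bdd
  refine ⟨hφ.meas.mul hψ.meas, C * D, fun x => ?_⟩
  rw [norm_mul]
  exact mul_le_mul (hC x) (hD x) (norm_nonneg _) ((norm_nonneg _).trans (hC x))

lemma const (c : ℂ) : BddMeas (fun _ => c) := ⟨measurable_const, ‖c‖, fun _ => le_rfl⟩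

lemma star (hφ : BddMeas φ) : BddMeas (fun x => (starRingEnd ℂ) (φ x)) := by
  obtain ⟨C, hC⟩ := hφ.bdd
  exact ⟨Complex.continuous_conj.measurable.comp hφ.meas, C, fun x => by simpa using hC x⟩

lemma indicator (hφ : BddMeas φ) {s : Set ℝ} (hs : MeasurableSet s) :
    BddMeas (s.indicator φ) := by
  obtain ⟨C, hC⟩ := hφ.bdd
  exact ⟨hφ.meas.indicator hs, C, fun x => (norm_indicator_le_norm_self φ x).trans (hC x)⟩

lemma integrable (hφ : BddMeas φ) (μ : Measure ℝ) [IsFiniteMeasure μ] : Integrable φ μ := by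
  obtain ⟨C, hC⟩ := hφ.bdd
  exact .of_bound hφ.meas.aestronglyMeasurable C (.of_forall hC)

end BddMeas

/-- The function `x ↦ (x - z)⁻¹`. -/
def cauchy (z : ℂ) (x : ℝ) : ℂ := ((x : ℂ) - z)⁻¹

lemma ofReal_sub_ne_zero {z : ℂ} (hz : z.im ≠ 0) (x : ℝ) : (x : ℂ) - z ≠ 0 := by
  intro h
  apply hz
  have := congrArg Complex.im h
  simpa using this

lemma abs_im_le_norm_ofReal_sub (z : ℂ) (x : ℝ) : |z.im| ≤ ‖(x : ℂ) - z‖ := by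
  have := Complex.abs_im_le_norm ((x : ℂ) - z)
  simpa using this

lemma norm_cauchy_le {z : ℂ} (hz : z.im ≠ 0) (x : ℝ) : ‖cauchy z x‖ ≤ |z.im|⁻¹ := by
  rw [cauchy, norm_inv]
  exact inv_anti₀ (abs_pos.2 hz) (abs_im_le_norm_ofReal_sub z x)

lemma continuous_cauchy {z : ℂ} (hz : z.im ≠ 0) : Continuous (cauchy z) := by
  unfold cauchy
  exact Continuous.inv₀ (by fun_prop) (ofReal_sub_ne_zero hz)

lemma bddMeas_cauchy {z : ℂ} (hz : z.im ≠ 0) : BddMeas (cauchy z) :=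
  .of_continuous (continuous_cauchy hz) (norm_cauchy_le hz)

lemma conj_cauchy (z : ℂ) (x : ℝ) :
    (starRingEnd ℂ) (cauchy z x) = cauchy ((starRingEnd ℂ) z) x := by
  simp [cauchy]

lemma clm_ext_inner_self {S T : 𝓗 →L[ℂ] 𝓗} (h : ∀ f, ⟪f, S f⟫_ℂ = ⟪f, T f⟫_ℂ) : S = T := by
  have : (S : 𝓗 →ₗ[ℂ] 𝓗) = T := by
    rw [← ext_inner_map]
    intro x
    have := congrArg (starRingEnd ℂ) (h x)
    simpa [inner_conj_symm] using this
  exact ContinuousLinearMap.coe_injective this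

/-- Pointwise convergence of quadratic forms gives weak convergence of operators. -/
lemma tendsto_inner_of_tendsto_inner_self {α : Type*} {l : Filter α} {S : α → 𝓗 →L[ℂ] 𝓗}
    {T : 𝓗 →L[ℂ] 𝓗} (h : ∀ f, Tendsto (fun a => ⟪f, S a f⟫_ℂ) l (𝓝 ⟪f, T f⟫_ℂ)) (f g : 𝓗) :
    Tendsto (fun a => ⟪f, S a g⟫_ℂ) l (𝓝 ⟪f, T g⟫_ℂ) := by
  have h' : ∀ f, Tendsto (fun a => ⟪S a f, f⟫_ℂ) l (𝓝 ⟪T f, f⟫_ℂ) := fun f => by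
    have := (Complex.continuous_conj.tendsto _).comp (h f)
    simpa [Function.comp_def, inner_conj_symm] using this
  have key : Tendsto (fun a => ⟪S a g, f⟫_ℂ) l (𝓝 ⟪T g, f⟫_ℂ) := by
    have e : ∀ R : 𝓗 →L[ℂ] 𝓗, ⟪R g, f⟫_ℂ = (⟪R (f + g), f + g⟫_ℂ - ⟪R (f - g), f - g⟫_ℂ
        + Complex.I * ⟪R (f + Complex.I • g), f + Complex.I • g⟫_ℂ
        - Complex.I * ⟪R (f - Complex.I • g), f - Complex.I • g⟫_ℂ) / 4 := fun R => by
      exact inner_map_polarization (R : 𝓗 →ₗ[ℂ] 𝓗) f g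
    simp_rw [e]
    exact ((((h' _).sub (h' _)).add ((h' _).const_mul _)).sub ((h' _).const_mul _)).div_const 4
  have := (Complex.continuous_conj.tendsto _).comp key
  simpa [Function.comp_def, inner_conj_symm] using this

namespace SpectralMeasure

variable {H : SelfAdjointOperator 𝓗} (E : SpectralMeasure H) {φ ψ : ℝ → ℂ}

instance isFiniteMeasure_scalar (f : 𝓗) : IsFiniteMeasure (E.scalar f) := E.scalar_finite f

lemma inner_fc (hφ : BddMeas φ) (f : 𝓗) : ⟪f, E.fc φ f⟫_ℂ = ∫ x, φ x ∂(E.scalar f) :=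
  E.fc_spec φ hφ.meas hφ.bdd f

lemma fc_add (hφ : BddMeas φ) (hψ : BddMeas ψ) :
    E.fc (fun x => φ x + ψ x) = E.fc φ + E.fc ψ :=
  clm_ext_inner_self fun f => by
    rw [E.inner_fc (hφ.add hψ), add_apply, inner_add_right, E.inner_fc hφ,
      E.inner_fc hψ, integral_add (hφ.integrable _) (hψ.integrable _)]

lemma inner_proj_self (s : Set ℝ) (hs : MeasurableSet s) (f : 𝓗) :
    ⟪f, E.proj s f⟫_ℂ = ((E.scalar f).real s : ℂ) := by
  have h1 : (starRingEnd ℂ) ⟪f, E.proj s f⟫_ℂ = ⟪f, E.proj s f⟫_ℂ := by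
    rw [inner_conj_symm]
    conv_lhs => rw [← (E.proj_sa s).adjoint_eq]
    rw [ContinuousLinearMap.adjoint_inner_left]
  have h2 := E.scalar_spec f s hs
  rw [Measure.real, h2]
  exact (Complex.conj_eq_iff_re.1 h1).symm

lemma fc_indicator_const (c : ℂ) {s : Set ℝ} (hs : MeasurableSet s) :
    E.fc (s.indicator fun _ => c) = c • E.proj s :=
  clm_ext_inner_self fun f => by
    rw [E.inner_fc ((BddMeas.const c).indicator hs), integral_indicator_const _ hs,
      smul_apply, inner_smul_right, E.inner_proj_self s hs]
    simp [mul_comm]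

lemma fc_const (c : ℂ) : E.fc (fun _ => c) = c • (1 : 𝓗 →L[ℂ] 𝓗) := by
  rw [← E.proj_univ, ← E.fc_indicator_const c MeasurableSet.univ, Set.indicator_univ]

lemma adjoint_fc (hφ : BddMeas φ) :
    ContinuousLinearMap.adjoint (E.fc φ) = E.fc (fun x => (starRingEnd ℂ) (φ x)) :=
  clm_ext_inner_self fun f => by
    rw [ContinuousLinearMap.adjoint_inner_right, E.inner_fc hφ.star, integral_conj,
      ← E.inner_fc hφ, inner_conj_symm]

lemma proj_apply_proj (s : Set ℝ) : E.proj s * E.proj s = E.proj s := by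
  have := E.proj_mul s s
  rw [Set.inter_self] at this
  exact this.symm

lemma scalar_proj {s : Set ℝ} (hs : MeasurableSet s) (f : 𝓗) :
    E.scalar (E.proj s f) = (E.scalar f).restrict s := by
  ext t ht
  rw [Measure.restrict_apply ht, ← ENNReal.toReal_eq_toReal_iff' (measure_ne_top _ _)
    (measure_ne_top _ _)]
  have h1 := E.inner_proj_self t ht (E.proj s f)
  have h2 := E.inner_proj_self (t ∩ s) (ht.inter hs) f
  have h3 : ⟪E.proj s f, E.proj t (E.proj s f)⟫_ℂ = ⟪f, E.proj (t ∩ s) f⟫_ℂ := by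
    conv_lhs => rw [← (E.proj_sa s).adjoint_eq]
    rw [ContinuousLinearMap.adjoint_inner_left, (E.proj_sa s).adjoint_eq]
    have : E.proj (t ∩ s) = E.proj s ∘L (E.proj t ∘L E.proj s) := by
      rw [← E.proj_mul, ← E.proj_mul, Set.inter_comm t s, ← Set.inter_assoc, Set.inter_self]
    rw [this]
    rfl
  rw [h3, h2] at h1
  exact_mod_cast h1.symm

lemma proj_mul_fc_mul_proj (hφ : BddMeas φ) {s : Set ℝ} (hs : MeasurableSet s) :
    E.proj s * (E.fc φ * E.proj s) = E.fc (s.indicator φ) :=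
  clm_ext_inner_self fun f => by
    rw [E.inner_fc (hφ.indicator hs), integral_indicator hs, ← E.scalar_proj hs,
      ← E.inner_fc hφ]
    conv_rhs => rw [← (E.proj_sa s).adjoint_eq]
    rw [ContinuousLinearMap.adjoint_inner_left, (E.proj_sa s).adjoint_eq]
    rfl

lemma proj_empty : E.proj ∅ = 0 :=
  clm_ext_inner_self fun f => by
    rw [E.inner_proj_self ∅ MeasurableSet.empty]
    simp

lemma proj_mul_fc (hφ : BddMeas φ) {s : Set ℝ} (hs : MeasurableSet s) :
    E.proj s * E.fc φ = E.fc (s.indicator φ) := by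
  have h1 : E.fc φ = E.fc (s.indicator φ) + E.fc (sᶜ.indicator φ) := by
    rw [← E.fc_add (hφ.indicator hs) (hφ.indicator hs.compl)]
    congr 1
    exact (Set.indicator_self_add_compl s φ).symm
  have h0 : E.proj s * E.proj sᶜ = 0 := by
    have := E.proj_mul s sᶜ
    rw [Set.inter_compl_self, E.proj_empty] at this
    exact this.symm
  conv_lhs => rw [h1]
  rw [← E.proj_mul_fc_mul_proj hφ hs, ← E.proj_mul_fc_mul_proj hφ hs.compl, mul_add,
    ← mul_assoc, E.proj_apply_proj, ← mul_assoc (E.proj s) (E.proj sᶜ), h0, zero_mul, add_zero]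

lemma simpleFunc_bddMeas (θ : SimpleFunc ℝ ℂ) : BddMeas θ :=
  ⟨θ.measurable, θ.exists_forall_norm_le⟩

lemma fc_simpleFunc_mul (θ : SimpleFunc ℝ ℂ) (hφ : BddMeas φ) :
    E.fc θ * E.fc φ = E.fc (fun x => θ x * φ x) := by
  induction θ using SimpleFunc.induction with
  | @const c s hs =>
    have e : ⇑(SimpleFunc.piecewise s hs (SimpleFunc.const ℝ c) (SimpleFunc.const ℝ 0))
        = s.indicator fun _ => c := by
      ext x
      by_cases hx : x ∈ s <;> simp [hx]
    rw [e, E.fc_indicator_const c hs, smul_mul_assoc, E.proj_mul_fc hφ hs]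
    have e2 : (fun x => s.indicator (fun _ => c) x * φ x)
        = fun x => (fun _ : ℝ => c) x * s.indicator φ x := by
      ext x
      by_cases hx : x ∈ s <;> simp [hx]
    rw [e2]
    refine clm_ext_inner_self fun f => ?_
    rw [E.inner_fc ((BddMeas.const c).mul (hφ.indicator hs)), integral_const_mul,
      smul_apply, inner_smul_right, E.inner_fc (hφ.indicator hs)]
  | @add f g _ hf hg =>
    rw [SimpleFunc.coe_add]
    have e : E.fc (⇑f + ⇑g) = E.fc f + E.fc g :=
      E.fc_add (simpleFunc_bddMeas f) (simpleFunc_bddMeas g)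
    rw [e, add_mul, hf, hg,
      ← E.fc_add ((simpleFunc_bddMeas f).mul hφ) ((simpleFunc_bddMeas g).mul hφ)]
    congr 1
    ext x
    simp [add_mul]

lemma fc_mul (hφ : BddMeas φ) (hψ : BddMeas ψ) :
    E.fc (fun x => φ x * ψ x) = E.fc φ * E.fc ψ := by
  obtain ⟨C, hC⟩ := hφ.bdd
  obtain ⟨D, hD⟩ := hψ.bdd
  have hC0 : 0 ≤ C := (norm_nonneg _).trans (hC 0)
  set θ := hφ.meas.stronglyMeasurable.approxBounded C
  have hθ : ∀ x, Tendsto (fun n => θ n x) atTop (𝓝 (φ x)) := fun x =>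
    StronglyMeasurable.tendsto_approxBounded_of_norm_le _ (hC x)
  have hθC : ∀ n x, ‖θ n x‖ ≤ C := fun n x =>
    StronglyMeasurable.norm_approxBounded_le _ hC0 n x
  refine clm_ext_inner_self fun f => ?_
  have h1 : Tendsto (fun n => ⟪f, E.fc (θ n) (E.fc ψ f)⟫_ℂ) atTop
      (𝓝 ⟪f, E.fc φ (E.fc ψ f)⟫_ℂ) := by
    refine tendsto_inner_of_tendsto_inner_self (fun g => ?_) _ _
    simp_rw [E.inner_fc hφ, fun n => E.inner_fc (simpleFunc_bddMeas (θ n)) g]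
    exact tendsto_integral_of_dominated_convergence (fun _ => C)
      (fun n => (simpleFunc_bddMeas (θ n)).meas.aestronglyMeasurable) (integrable_const _)
      (fun n => .of_forall (hθC n)) (.of_forall hθ)
  have h2 : Tendsto (fun n => ⟪f, E.fc (θ n) (E.fc ψ f)⟫_ℂ) atTop
      (𝓝 ⟪f, E.fc (fun x => φ x * ψ x) f⟫_ℂ) := by
    have e : ∀ n, ⟪f, E.fc (θ n) (E.fc ψ f)⟫_ℂ = ∫ x, θ n x * ψ x ∂(E.scalar f) := fun n => by
      rw [← E.inner_fc ((simpleFunc_bddMeas (θ n)).mul hψ), ← E.fc_simpleFunc_mul _ hψ]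
      rfl
    simp_rw [e, E.inner_fc (hφ.mul hψ)]
    refine tendsto_integral_of_dominated_convergence (fun _ => C * D)
      (fun n => ((simpleFunc_bddMeas (θ n)).mul hψ).meas.aestronglyMeasurable)
      (integrable_const _) (fun n => .of_forall fun x => ?_)
      (.of_forall fun x => (hθ x).mul_const _)
    rw [norm_mul]
    exact mul_le_mul (hθC n x) (hD x) (norm_nonneg _) hC0
  exact tendsto_nhds_unique h2 h1

lemma integral_norm_sq_eq (hφ : BddMeas φ) (f : 𝓗) :
    ‖E.fc φ f‖ ^ 2 = ∫ x, ‖φ x‖ ^ 2 ∂(E.scalar f) := by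
  have h : ⟪f, E.fc (fun x => (starRingEnd ℂ) (φ x) * φ x) f⟫_ℂ = (‖E.fc φ f‖ : ℂ) ^ 2 := by
    rw [E.fc_mul hφ.star hφ, ← E.adjoint_fc hφ, mul_apply_eq_comp,
      ContinuousLinearMap.adjoint_inner_right, inner_self_eq_norm_sq_to_K]
    rfl
  rw [E.inner_fc (hφ.star.mul hφ)] at h
  have e : ∀ x, (starRingEnd ℂ) (φ x) * φ x = ((‖φ x‖ ^ 2 : ℝ) : ℂ) := fun x => by
    rw [Complex.conj_mul']
    push_cast
    rfl
  simp_rw [e] at h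
  rw [integral_complex_ofReal] at h
  exact_mod_cast h.symm

lemma scalar_real_univ (f : 𝓗) : (E.scalar f).real Set.univ = ‖f‖ ^ 2 := by
  have h := E.integral_norm_sq_eq (BddMeas.const 1) f
  rw [E.fc_const] at h
  simpa using h.symm

lemma norm_fc_le (hφ : BddMeas φ) {C : ℝ} (hC : ∀ x, ‖φ x‖ ≤ C) : ‖E.fc φ‖ ≤ C := by
  have hC0 : 0 ≤ C := (norm_nonneg _).trans (hC 0)
  refine ContinuousLinearMap.opNorm_le_bound _ hC0 fun f => ?_
  rw [← sq_le_sq₀ (norm_nonneg _) (by positivity), E.integral_norm_sq_eq hφ, mul_pow,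
    ← E.scalar_real_univ f]
  have : ∫ x, ‖φ x‖ ^ 2 ∂(E.scalar f) ≤ ∫ _, C ^ 2 ∂(E.scalar f) := by
    refine integral_mono_of_nonneg (.of_forall fun x => by positivity) (integrable_const _)
      (.of_forall fun x => ?_)
    exact pow_le_pow_left₀ (norm_nonneg _) (hC x) 2
  simpa [mul_comm] using this

lemma resolvent_eq_fc {z : ℂ} (hz : z.im ≠ 0) : H.resolvent z = E.fc (cauchy z) :=
  clm_ext_inner_self fun f => by
    rw [E.resolvent_spec z hz f, E.inner_fc (bddMeas_cauchy hz)]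
    rfl

lemma adjoint_fc_cauchy {z : ℂ} (hz : z.im ≠ 0) :
    ContinuousLinearMap.adjoint (E.fc (cauchy z)) = E.fc (cauchy ((starRingEnd ℂ) z)) := by
  rw [E.adjoint_fc (bddMeas_cauchy hz)]
  congr 1
  ext x
  exact conj_cauchy z x

end SpectralMeasure

namespace IsTraceClass

variable {S T : 𝓗 →L[ℂ] 𝓗}

lemma add (hS : IsTraceClass S) (hT : IsTraceClass T) : IsTraceClass (S + T) := by
  obtain ⟨C, hC⟩ := hS
  obtain ⟨D, hD⟩ := hT
  refine ⟨C + D, fun n e f he hf => ?_⟩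
  refine le_trans ?_ (add_le_add (hC n e f he hf) (hD n e f he hf))
  rw [← Finset.sum_add_distrib]
  refine Finset.sum_le_sum fun i _ => ?_
  rw [add_apply, inner_add_right]
  exact norm_add_le _ _

lemma zero : IsTraceClass (0 : 𝓗 →L[ℂ] 𝓗) := ⟨0, fun n e f _ _ => by simp⟩

lemma smul (c : ℂ) (hT : IsTraceClass T) : IsTraceClass (c • T) := by
  obtain ⟨D, hD⟩ := hT
  refine ⟨‖c‖ * D, fun n e f he hf => ?_⟩
  refine le_trans (le_of_eq ?_) (mul_le_mul_of_nonneg_left (hD n e f he hf) (norm_nonneg c))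
  rw [Finset.mul_sum]
  refine Finset.sum_congr rfl fun i _ => ?_
  rw [smul_apply, inner_smul_right, norm_mul]

lemma sum {ι : Type*} (s : Finset ι) {F : ι → 𝓗 →L[ℂ] 𝓗} (h : ∀ i ∈ s, IsTraceClass (F i)) :
    IsTraceClass (∑ i ∈ s, F i) :=
  Finset.sum_induction F IsTraceClass (fun _ _ => add) zero h

lemma orthonormal_unitary {n : ℕ} {e : Fin n → 𝓗} (he : Orthonormal ℂ e)
    (u : unitary (𝓗 →L[ℂ] 𝓗)) : Orthonormal ℂ (fun i => (u : 𝓗 →L[ℂ] 𝓗) (e i)) := by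
  have := he.comp_linearIsometry (Unitary.linearIsometryEquiv u).toLinearIsometry
  exact this

lemma mul_unitary (hT : IsTraceClass T) (u : unitary (𝓗 →L[ℂ] 𝓗)) :
    IsTraceClass (T * (u : 𝓗 →L[ℂ] 𝓗)) := by
  obtain ⟨D, hD⟩ := hT
  exact ⟨D, fun n e f he hf => hD n e _ he (orthonormal_unitary hf u)⟩

lemma unitary_mul (hT : IsTraceClass T) (u : unitary (𝓗 →L[ℂ] 𝓗)) :
    IsTraceClass ((u : 𝓗 →L[ℂ] 𝓗) * T) := by
  obtain ⟨D, hD⟩ := hT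
  refine ⟨D, fun n e f he hf => ?_⟩
  refine le_trans (le_of_eq ?_) (hD n _ f (orthonormal_unitary he (star u)) hf)
  refine Finset.sum_congr rfl fun i _ => ?_
  rw [Unitary.coe_star, ContinuousLinearMap.star_eq_adjoint,
    ContinuousLinearMap.adjoint_inner_left]
  rfl

lemma mul_right (hT : IsTraceClass T) (X : 𝓗 →L[ℂ] 𝓗) : IsTraceClass (T * X) := by
  obtain ⟨u, c, h, -⟩ := CStarAlgebra.exists_sum_four_unitary X
  rw [h, Finset.mul_sum]
  refine sum _ fun i _ => ?_
  rw [mul_smul_comm]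
  exact (hT.mul_unitary _).smul _

lemma mul_left (hT : IsTraceClass T) (X : 𝓗 →L[ℂ] 𝓗) : IsTraceClass (X * T) := by
  obtain ⟨u, c, h, -⟩ := CStarAlgebra.exists_sum_four_unitary X
  rw [h, Finset.sum_mul]
  refine sum _ fun i _ => ?_
  rw [smul_mul_assoc]
  exact (hT.unitary_mul _).smul _

lemma summable_norm_inner (hT : IsTraceClass T) {ι : Type*} {e : ι → 𝓗} (he : Orthonormal ℂ e) :
    Summable fun i => ‖⟪e i, T (e i)⟫_ℂ‖ := by
  obtain ⟨D, hD⟩ := hT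
  refine summable_of_sum_le (c := D) (fun i => norm_nonneg _) fun s => ?_
  have h := hD s.card (fun i => e (s.equivFin.symm i)) (fun i => e (s.equivFin.symm i))
    (he.comp _ (Subtype.val_injective.comp s.equivFin.symm.injective))
    (he.comp _ (Subtype.val_injective.comp s.equivFin.symm.injective))
  refine le_trans (le_of_eq ?_) h
  rw [← Finset.sum_coe_sort s]
  exact (Equiv.sum_comp s.equivFin.symm (fun i : s => ‖⟪e i, T (e i)⟫_ℂ‖)).symm

/-- A trace class operator is compact. -/
lemma isCompactOperator (hT : IsTraceClass T) : IsCompactOperator T := by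
  classical
  obtain ⟨w, b, -⟩ := exists_hilbertBasis ℂ 𝓗
  have hsum : Summable fun i => ‖T (b i)‖ ^ 2 := by
    have h := (hT.mul_left (star T)).summable_norm_inner b.orthonormal
    refine h.congr fun i => ?_
    rw [mul_apply_eq_comp, ContinuousLinearMap.star_eq_adjoint,
      ContinuousLinearMap.adjoint_inner_right, inner_self_eq_norm_sq_to_K]
    simp
  let F : Finset w → 𝓗 →L[ℂ] 𝓗 := fun s => ∑ i ∈ s, InnerProductSpace.rankOne ℂ (T (b i)) (b i)
  have hF : ∀ s, IsCompactOperator (F s) := fun s => by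
    have : F s ∈ compactOperator (RingHom.id ℂ) 𝓗 𝓗 :=
      Submodule.sum_mem _ fun i _ => by
        change IsCompactOperator _
        have : (InnerProductSpace.rankOne ℂ (T (b i)) (b i) : 𝓗 → 𝓗)
            = (fun c : ℂ => c • T (b i)) ∘ (innerSL ℂ (b i)) := by
          ext x
          simp
        rw [this]
        have hc : IsCompactOperator (innerSL ℂ (b i) : 𝓗 → ℂ) := by
          exact isCompactOperator_of_locallyCompactSpace_dom _
        exact hc.clm_comp (ContinuousLinearMap.smulRight (1 : ℂ →L[ℂ] ℂ) (T (b i)))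
    exact this
  refine isCompactOperator_of_tendsto (l := atTop) (F := F) ?_ (.of_forall hF)
  have htail := tendsto_tsum_compl_atTop_zero fun i => ‖T (b i)‖ ^ 2
  have htail' := (Real.continuous_sqrt.tendsto 0).comp htail
  rw [Real.sqrt_zero] at htail'
  rw [tendsto_iff_norm_sub_tendsto_zero]
  refine squeeze_zero (fun _ => norm_nonneg _) (fun s => ?_) htail'
  refine ContinuousLinearMap.opNorm_le_bound _ (Real.sqrt_nonneg _) fun x => ?_
  have h1 : Tendsto (fun t => F t x) atTop (𝓝 (T x)) := by
    have h := (b.hasSum_repr x).mapL T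
    refine Tendsto.congr (fun t => ?_) h
    simp only [F, sum_apply, InnerProductSpace.rankOne_apply, map_smul,
      b.repr_apply_apply]
  rw [sub_apply, norm_sub_rev]
  refine le_of_tendsto ((h1.sub_const (F s x)).norm) ?_
  filter_upwards [eventually_ge_atTop s] with t hst
  have h2 : F t x - F s x = ∑ i ∈ t \ s, ⟪b i, x⟫_ℂ • T (b i) := by
    simp only [F, sum_apply, InnerProductSpace.rankOne_apply]
    rw [← Finset.sum_sdiff hst, add_sub_cancel_right]
  rw [h2]
  have hsub : Summable fun i : {i // i ∉ s} => ‖T (b i)‖ ^ 2 :=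
    hsum.subtype _
  calc ‖∑ i ∈ t \ s, ⟪b i, x⟫_ℂ • T (b i)‖
      ≤ ∑ i ∈ t \ s, ‖T (b i)‖ * ‖⟪b i, x⟫_ℂ‖ := by
        refine (norm_sum_le _ _).trans (le_of_eq (Finset.sum_congr rfl fun i _ => ?_))
        rw [norm_smul, mul_comm]
    _ ≤ √(∑ i ∈ t \ s, ‖T (b i)‖ ^ 2) * √(∑ i ∈ t \ s, ‖⟪b i, x⟫_ℂ‖ ^ 2) :=
        Real.sum_mul_le_sqrt_mul_sqrt _ _ _
    _ ≤ _ := by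
        refine mul_le_mul (Real.sqrt_le_sqrt ?_) ?_ (Real.sqrt_nonneg _) (Real.sqrt_nonneg _)
        · rw [← Finset.sum_subtype_of_mem (p := fun i => i ∉ s)
            (fun i => ‖T (b i)‖ ^ 2) (fun i hi => (Finset.mem_sdiff.1 hi).2)]
          exact hsub.sum_le_tsum _ fun _ _ => by positivity
        · rw [Real.sqrt_le_left (norm_nonneg x)]
          exact b.orthonormal.sum_inner_products_le x

end IsTraceClass

/-- The operator `∑ lam j |e j⟩⟨e j|`. -/
def diagOp {ι : Type*} (e : ι → 𝓗) (lam : ι → ℝ) : 𝓗 →L[ℂ] 𝓗 :=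
  ∑' j, (lam j : ℂ) • InnerProductSpace.rankOne ℂ (e j) (e j)

section diagOp

variable {ι : Type*} {e : ι → 𝓗} {lam : ι → ℝ}

lemma summable_diagOp (he : Orthonormal ℂ e) (hl : Summable lam) :
    Summable fun j => (lam j : ℂ) • InnerProductSpace.rankOne ℂ (e j) (e j) := by
  refine Summable.of_norm (hl.abs.congr fun j => ?_)
  rw [norm_smul, InnerProductSpace.norm_rankOne, he.1 j]
  simp

lemma hasSum_diagOp_apply (he : Orthonormal ℂ e) (hl : Summable lam) (x : 𝓗) :
    HasSum (fun j => ((lam j : ℂ) * ⟪e j, x⟫_ℂ) • e j) (diagOp e lam x) := by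
  unfold diagOp
  have h := (summable_diagOp he hl).hasSum.mapL (ContinuousLinearMap.apply ℂ 𝓗 x)
  simpa only [ContinuousLinearMap.apply_apply, smul_apply, InnerProductSpace.rankOne_apply,
    smul_smul] using h

lemma isSelfAdjoint_diagOp : IsSelfAdjoint (diagOp e lam) := by
  rw [IsSelfAdjoint, diagOp, tsum_star]
  congr 1
  ext1 j
  rw [star_smul, ContinuousLinearMap.star_eq_adjoint, InnerProductSpace.adjoint_rankOne]
  simp

lemma diagOp_apply_self (he : Orthonormal ℂ e) (hl : Summable lam) (j : ι) :
    diagOp e lam (e j) = (lam j : ℂ) • e j := by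
  refine (hasSum_diagOp_apply he hl (e j)).unique ?_
  have := hasSum_single (f := fun i => ((lam i : ℂ) * ⟪e i, e j⟫_ℂ) • e i) j
    (fun i hi => by rw [he.2 hi]; simp)
  simpa [inner_self_eq_norm_sq_to_K, he.1 j] using this

/-- Diagonalisation of self-adjoint trace class operators. -/
lemma IsTraceClass.exists_eq_diagOp {T : 𝓗 →L[ℂ] 𝓗} (hT : IsTraceClass T)
    (hsa : IsSelfAdjoint T) :
    ∃ (w : (μ : ℂ) → Set (Module.End.eigenspace (T : 𝓗 →ₗ[ℂ] 𝓗) μ)) (e : (Σ μ, w μ) → 𝓗)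
      (lam : (Σ μ, w μ) → ℝ), Orthonormal ℂ e ∧ Summable lam ∧ T = diagOp e lam := by
  have hsym : (T : 𝓗 →ₗ[ℂ] 𝓗).IsSymmetric := hsa.isSymmetric
  have hclosed : ∀ μ, IsClosed (Module.End.eigenspace (T : 𝓗 →ₗ[ℂ] 𝓗) μ : Set 𝓗) := fun μ => by
    have : (Module.End.eigenspace (T : 𝓗 →ₗ[ℂ] 𝓗) μ : Set 𝓗) = {x | T x = μ • x} := by
      ext x
      simp
    rw [this]
    exact isClosed_eq T.continuous (continuous_const_smul μ)
  have hcomplete : ∀ μ, CompleteSpace (Module.End.eigenspace (T : 𝓗 →ₗ[ℂ] 𝓗) μ) := fun μ =>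
    (hclosed μ).completeSpace_coe
  choose w b hb using fun μ =>
    exists_hilbertBasis ℂ (Module.End.eigenspace (T : 𝓗 →ₗ[ℂ] 𝓗) μ)
  let e : (Σ μ, w μ) → 𝓗 := fun a => (b a.1 a.2 : Module.End.eigenspace (T : 𝓗 →ₗ[ℂ] 𝓗) a.1)
  have he : Orthonormal ℂ e :=
    hsym.orthogonalFamily_eigenspaces.orthonormal_sigma_orthonormal
      (v_family := fun μ => b μ) fun μ => (b μ).orthonormal
  have heig : ∀ a, T (e a) = a.1 • e a := fun a =>
    Module.End.mem_eigenspace_iff.1 (b a.1 a.2).2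
  have hspan : (Submodule.span ℂ (range e))ᗮ = ⊥ := by
    rw [eq_bot_iff, ← T.orthogonalComplement_iSup_eigenspaces_eq_bot hT.isCompactOperator hsym,
      ← Submodule.triorthogonal_eq_orthogonal]
    refine Submodule.orthogonal_le (iSup_le fun μ x hx => ?_)
    have h1 := (b μ).hasSum_repr ⟨x, hx⟩
    have h2 := h1.mapL (Module.End.eigenspace (T : 𝓗 →ₗ[ℂ] 𝓗) μ).subtypeL
    refine (Submodule.isClosed_orthogonal _).mem_of_tendsto h2 (.of_forall fun s => ?_)
    refine Submodule.sum_mem _ fun i _ => ?_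
    rw [map_smul]
    exact Submodule.smul_mem _ _ (Submodule.le_orthogonal_orthogonal _
      (Submodule.subset_span ⟨⟨μ, i⟩, rfl⟩))
  have hinner : ∀ a, ⟪e a, T (e a)⟫_ℂ = a.1 := fun a => by
    rw [heig, inner_smul_right, inner_self_eq_norm_sq_to_K, he.1 a]
    simp
  have hreal : ∀ a : Σ μ, w μ, ((a.1.re : ℝ) : ℂ) = a.1 := fun a => by
    rw [← Complex.conj_eq_iff_re, ← hinner a, inner_conj_symm]
    exact hsym _ _
  have hsum : Summable fun a : Σ μ, w μ => a.1.re :=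
    Summable.of_norm ((hT.summable_norm_inner he).congr fun a => by
      rw [hinner a, ← hreal a, Complex.norm_real, Complex.ofReal_re])
  refine ⟨w, e, fun a => a.1.re, he, hsum, ?_⟩
  have hd := (HilbertBasis.mkOfOrthogonalEqBot he hspan).dense_span
  rw [HilbertBasis.coe_mkOfOrthogonalEqBot] at hd
  refine ContinuousLinearMap.ext_on (Submodule.dense_iff_topologicalClosure_eq_top.2 hd) ?_
  rintro _ ⟨a, rfl⟩
  rw [diagOp_apply_self he hsum, heig, hreal]

end diagOp

section traceForm

variable {ι : Type*} {e : ι → 𝓗} {lam : ι → ℝ}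

/-- The functional `X ↦ Tr (X D)` for the operator `D = ∑ lam j |e j⟩⟨e j|`. -/
def traceForm (e : ι → 𝓗) (lam : ι → ℝ) : (𝓗 →L[ℂ] 𝓗) →L[ℂ] ℂ :=
  ∑' j, (lam j : ℂ) • (innerSL ℂ (e j)).comp (ContinuousLinearMap.apply ℂ 𝓗 (e j))

lemma norm_inner_apply_le (he : Orthonormal ℂ e) (X : 𝓗 →L[ℂ] 𝓗) (j : ι) :
    ‖⟪e j, X (e j)⟫_ℂ‖ ≤ ‖X‖ := by
  refine (norm_inner_le_norm _ _).trans ?_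
  rw [he.1 j, one_mul]
  simpa [he.1 j] using X.le_opNorm (e j)

lemma hasSum_traceForm (he : Orthonormal ℂ e) (hl : Summable lam) (X : 𝓗 →L[ℂ] 𝓗) :
    HasSum (fun j => (lam j : ℂ) * ⟪e j, X (e j)⟫_ℂ) (traceForm e lam X) := by
  have hs : Summable fun j => (lam j : ℂ) •
      (innerSL ℂ (e j)).comp (ContinuousLinearMap.apply ℂ 𝓗 (e j)) := by
    refine Summable.of_norm_bounded hl.abs fun j => ?_
    rw [norm_smul, Complex.norm_real, Real.norm_eq_abs]
    refine mul_le_of_le_one_right (abs_nonneg _) ?_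
    refine ContinuousLinearMap.opNorm_le_bound _ zero_le_one fun X => ?_
    rw [one_mul]
    exact norm_inner_apply_le he X j
  unfold traceForm
  exact hs.hasSum.mapL (ContinuousLinearMap.apply ℂ ℂ X)

lemma norm_traceForm_le (he : Orthonormal ℂ e) (hl : Summable lam) (X : 𝓗 →L[ℂ] 𝓗) :
    ‖traceForm e lam X‖ ≤ (∑' j, |lam j|) * ‖X‖ := by
  rw [← (hasSum_traceForm he hl X).tsum_eq, ← tsum_mul_right]
  refine tsum_of_norm_bounded (hl.abs.mul_right _).hasSum fun j => ?_
  rw [norm_mul, Complex.norm_real, Real.norm_eq_abs]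
  exact mul_le_mul_of_nonneg_left (norm_inner_apply_le he X j) (abs_nonneg _)

lemma traceForm_star (he : Orthonormal ℂ e) (hl : Summable lam) (X : 𝓗 →L[ℂ] 𝓗) :
    traceForm e lam (star X) = (starRingEnd ℂ) (traceForm e lam X) := by
  refine (hasSum_traceForm he hl _).unique ?_
  have h := (hasSum_traceForm he hl X).map (starRingEnd ℂ) Complex.continuous_conj
  refine h.congr_fun fun j => ?_
  rw [Function.comp_apply, map_mul, Complex.conj_ofReal, inner_conj_symm,
    ContinuousLinearMap.star_eq_adjoint, ContinuousLinearMap.adjoint_inner_right]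

lemma tsum_norm_inner_mul_le {κ : Type*} (b : HilbertBasis κ ℂ 𝓗) (x y : 𝓗) :
    ∑' i, ‖⟪x, b i⟫_ℂ * ⟪b i, y⟫_ℂ‖ ≤ ‖x‖ * ‖y‖ := by
  refine (b.summable_inner_mul_inner x y).norm.tsum_le_of_sum_le fun s => ?_
  calc ∑ i ∈ s, ‖⟪x, b i⟫_ℂ * ⟪b i, y⟫_ℂ‖ = ∑ i ∈ s, ‖⟪b i, x⟫_ℂ‖ * ‖⟪b i, y⟫_ℂ‖ :=
        Finset.sum_congr rfl fun i _ => by rw [norm_mul, norm_inner_symm]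
    _ ≤ √(∑ i ∈ s, ‖⟪b i, x⟫_ℂ‖ ^ 2) * √(∑ i ∈ s, ‖⟪b i, y⟫_ℂ‖ ^ 2) :=
        Real.sum_mul_le_sqrt_mul_sqrt _ _ _
    _ ≤ ‖x‖ * ‖y‖ := by
        refine mul_le_mul ?_ ?_ (Real.sqrt_nonneg _) (norm_nonneg _) <;>
        · rw [Real.sqrt_le_left (norm_nonneg _)]
          exact b.orthonormal.sum_inner_products_le _

/-- `Tr (X D Y) = Tr (Y X D)`, the left-hand side being computed in an arbitrary basis. -/
lemma hasSum_inner_mul_diagOp_mul {κ : Type*} (b : HilbertBasis κ ℂ 𝓗) (he : Orthonormal ℂ e)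
    (hl : Summable lam) (X Y : 𝓗 →L[ℂ] 𝓗) :
    HasSum (fun i => ⟪b i, (X * diagOp e lam * Y) (b i)⟫_ℂ) (traceForm e lam (Y * X)) := by
  let F : ι × κ → ℂ := fun p =>
    (lam p.1 : ℂ) * (⟪star Y (e p.1), b p.2⟫_ℂ * ⟪b p.2, X (e p.1)⟫_ℂ)
  have hrow : ∀ j, HasSum (fun i => F (j, i)) ((lam j : ℂ) * ⟪e j, (Y * X) (e j)⟫_ℂ) := fun j => by
    have h := (b.hasSum_inner_mul_inner (star Y (e j)) (X (e j))).mul_left (lam j : ℂ)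
    rw [ContinuousLinearMap.star_eq_adjoint, ContinuousLinearMap.adjoint_inner_left] at h
    exact h
  have hcol : ∀ i, HasSum (fun j => F (j, i)) ⟪b i, (X * diagOp e lam * Y) (b i)⟫_ℂ := fun i => by
    have h := (hasSum_diagOp_apply he hl (Y (b i))).mapL ((innerSL ℂ (b i)).comp X)
    refine h.congr_fun fun j => ?_
    simp only [F, ContinuousLinearMap.comp_apply, map_smul, innerSL_apply_apply, smul_eq_mul,
      ContinuousLinearMap.star_eq_adjoint, ContinuousLinearMap.adjoint_inner_left]
    ring
  have hF : Summable F := by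
    refine Summable.of_norm ((summable_prod_of_nonneg fun _ => norm_nonneg _).2
      ⟨fun j => (hrow j).summable.norm, ?_⟩)
    refine Summable.of_nonneg_of_le (fun j => tsum_nonneg fun i => norm_nonneg _) (fun j => ?_)
      (hl.abs.mul_right (‖Y‖ * ‖X‖))
    have h1 : ∀ i, ‖F (j, i)‖ = |lam j| * ‖⟪star Y (e j), b i⟫_ℂ * ⟪b i, X (e j)⟫_ℂ‖ := fun i => by
      simp only [F]
      rw [norm_mul, Complex.norm_real, Real.norm_eq_abs]
    simp_rw [h1]
    rw [tsum_mul_left]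
    refine mul_le_mul_of_nonneg_left ((tsum_norm_inner_mul_le b _ _).trans ?_) (abs_nonneg _)
    have h2 : ‖star Y (e j)‖ ≤ ‖Y‖ := by
      simpa [he.1 j] using (star Y).le_opNorm (e j)
    have h3 : ‖X (e j)‖ ≤ ‖X‖ := by simpa [he.1 j] using X.le_opNorm (e j)
    exact mul_le_mul h2 h3 (norm_nonneg _) (norm_nonneg _)
  have h1 := hF.hasSum.prod_fiberwise hrow
  have h2 : HasSum (F ∘ Prod.swap) (∑' p, F p) :=
    (Equiv.prodComm κ ι).hasSum_iff.2 hF.hasSum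
  have h3 := HasSum.prod_fiberwise h2 hcol
  rw [(hasSum_traceForm he hl (Y * X)).unique h1]
  exact h3

end traceForm

/-- The identification of the unit circle in `ℂ` with `ℝ / ℤ`. -/
def sphereToAddCircle : C(Metric.sphere (0 : ℂ) 1, UnitAddCircle) where
  toFun w := (AddCircle.homeomorphCircle one_ne_zero).symm (⟨w.1, w.2⟩ : Circle)
  continuous_toFun := (Homeomorph.continuous _).comp
    (continuous_id : Continuous (id : Metric.sphere (0 : ℂ) 1 → Metric.sphere (0 : ℂ) 1))

lemma fourier_one_sphereToAddCircle (w : Metric.sphere (0 : ℂ) 1) :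
    fourier 1 (sphereToAddCircle w) = (w : ℂ) := by
  rw [fourier_apply, one_smul]
  have := (AddCircle.homeomorphCircle (T := 1) one_ne_zero).apply_symm_apply (⟨w.1, w.2⟩ : Circle)
  rw [AddCircle.homeomorphCircle_apply] at this
  exact congrArg (Subtype.val) this

/-- The continuous functional calculus of a unitary operator. -/
def unitCalc (u : unitary (𝓗 →L[ℂ] 𝓗)) : C(UnitAddCircle, ℂ) →⋆ₐ[ℂ] (𝓗 →L[ℂ] 𝓗) :=
  (cfcHomSuperset (R := ℂ) (p := IsStarNormal) (a := (u : 𝓗 →L[ℂ] 𝓗)) (inferInstance)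
    (s := Metric.sphere (0 : ℂ) 1) (spectrum.subset_circle_of_unitary u.2)).comp
    (ContinuousMap.compStarAlgHom' ℂ ℂ sphereToAddCircle)

lemma unitCalc_fourier_one (u : unitary (𝓗 →L[ℂ] 𝓗)) :
    unitCalc u (fourier 1) = (u : 𝓗 →L[ℂ] 𝓗) := by
  have h : ContinuousMap.compStarAlgHom' ℂ ℂ sphereToAddCircle (fourier 1)
      = (ContinuousMap.id ℂ).restrict (Metric.sphere (0 : ℂ) 1) := by
    ext w
    exact fourier_one_sphereToAddCircle w
  rw [unitCalc, StarAlgHom.comp_apply, h]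
  exact cfcHomSuperset_id _ _

lemma fourier_natCast (n : ℕ) : (fourier (n : ℤ) : C(UnitAddCircle, ℂ)) = fourier 1 ^ n := by
  induction n with
  | zero => ext x; simp
  | succ n ih =>
    ext x
    rw [pow_succ, ← ih]
    push_cast
    rw [fourier_add]
    rfl

lemma unitCalc_fourier_natCast (u : unitary (𝓗 →L[ℂ] 𝓗)) (n : ℕ) :
    unitCalc u (fourier (n : ℤ)) = (u : 𝓗 →L[ℂ] 𝓗) ^ n := by
  rw [fourier_natCast, map_pow, unitCalc_fourier_one]

lemma norm_unitCalc_le (u : unitary (𝓗 →L[ℂ] 𝓗)) (g : C(UnitAddCircle, ℂ)) :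
    ‖unitCalc u g‖ ≤ ‖g‖ :=
  NonUnitalStarAlgHom.norm_apply_le (unitCalc u) g

lemma continuous_unitCalc {u : ℝ → unitary (𝓗 →L[ℂ] 𝓗)} (hu : Continuous u)
    (g : C(UnitAddCircle, ℂ)) : Continuous fun s => unitCalc (u s) g :=
  continuous_cfcHomSuperset_left (isCompact_sphere (0 : ℂ) 1)
    (ContinuousMap.compStarAlgHom' ℂ ℂ sphereToAddCircle g)
    (fun s => (u s : 𝓗 →L[ℂ] 𝓗)) (continuous_subtype_val.comp hu)
    (fun s => spectrum.subset_circle_of_unitary (u s).2)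
    (fun s => (inferInstance : IsStarNormal (u s : 𝓗 →L[ℂ] 𝓗)))

lemma pow_sub_pow_eq_sum {R : Type*} [Ring R] (x y : R) (n : ℕ) :
    x ^ n - y ^ n = ∑ j ∈ Finset.range n, x ^ j * (x - y) * y ^ (n - 1 - j) := by
  induction n with
  | zero => simp
  | succ n ih =>
    rw [Finset.sum_range_succ]
    have h : ∑ j ∈ Finset.range n, x ^ j * (x - y) * y ^ (n + 1 - 1 - j)
        = (∑ j ∈ Finset.range n, x ^ j * (x - y) * y ^ (n - 1 - j)) * y := by
      rw [Finset.sum_mul]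
      refine Finset.sum_congr rfl fun j hj => ?_
      rw [mul_assoc _ _ y, ← pow_succ]
      have := Finset.mem_range.1 hj
      congr 2
      omega
    rw [h, ← ih, Nat.add_sub_cancel, Nat.sub_self, pow_zero, mul_one, pow_succ, pow_succ]
    noncomm_ring

lemma hasDerivAt_sub_mul {q F : ℝ → ℂ} {c : ℂ} {s : ℝ} (hq : HasDerivAt q c s)
    (hF : ContinuousAt F s) : HasDerivAt (fun t => (q t - q s) * F t) (c * F s) s := by
  rw [hasDerivAt_iff_tendsto_slope] at hq ⊢
  have h := hq.mul (hF.tendsto.mono_left (nhdsWithin_le_nhds (s := {s}ᶜ)))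
  refine h.congr fun t => ?_
  simp only [slope, vsub_eq_sub, sub_self, zero_mul, sub_zero, smul_mul_assoc]

/-- A path of unitaries whose increments have the form `(q t - q s) G t D (A s)⋆` for a fixed
self-adjoint trace class operator `D = ∑ lam j |e j⟩⟨e j|`. -/
structure UnitaryPath {ι : Type*} (e : ι → 𝓗) (lam : ι → ℝ) where
  u : ℝ → unitary (𝓗 →L[ℂ] 𝓗)
  A : ℝ → 𝓗 →L[ℂ] 𝓗
  G : ℝ → 𝓗 →L[ℂ] 𝓗
  q : ℝ → ℂ
  q' : ℝ → ℂ
  continuous_u : Continuous u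
  continuous_A : Continuous A
  continuous_G : Continuous G
  hasDerivAt_q : ∀ s, HasDerivAt q (q' s) s
  sub_eq : ∀ s t, (u t : 𝓗 →L[ℂ] 𝓗) - u s = (q t - q s) • (G t * diagOp e lam * star (A s))
  deriv_eq : ∀ s, q' s • G s = I • ((u s : 𝓗 →L[ℂ] 𝓗) * A s)

/-- `Tr (U' ^ n - U ^ n) = i n Λ (ζ ^ n)` for all `n ≥ 1`, with the left-hand side
computed in any Hilbert basis. -/
def HasShift (U U' : 𝓗 →L[ℂ] 𝓗) (L : C(UnitAddCircle, ℂ) →ₗ[ℂ] ℂ) : Prop :=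
  (∀ g, L (star g) = (starRingEnd ℂ) (L g)) ∧
  ∀ (κ : Set 𝓗) (b : HilbertBasis κ ℂ 𝓗) (n : ℕ), 1 ≤ n →
    HasSum (fun i => ⟪b i, (U' ^ n - U ^ n) (b i)⟫_ℂ) (I * n * L (fourier (n : ℤ)))

namespace UnitaryPath

variable {ι : Type*} {e : ι → 𝓗} {lam : ι → ℝ} (p : UnitaryPath e lam)

/-- The density of the shift functional along a path. -/
def density (g : C(UnitAddCircle, ℂ)) (s : ℝ) : ℂ :=
  traceForm e lam (star (p.A s) * unitCalc (p.u s) g * p.A s)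

lemma continuous_density (g : C(UnitAddCircle, ℂ)) : Continuous (p.density g) := by
  have h1 := continuous_unitCalc p.continuous_u g
  have h2 := p.continuous_A
  unfold density
  exact (traceForm e lam).continuous.comp ((h2.star.mul h1).mul h2)

/-- The shift functional of a path. -/
def shift (α β : ℝ) : C(UnitAddCircle, ℂ) →ₗ[ℂ] ℂ where
  toFun g := ∫ s in α..β, p.density g s
  map_add' g g' := by
    rw [← intervalIntegral.integral_add ((p.continuous_density g).intervalIntegrable _ _)
      ((p.continuous_density g').intervalIntegrable _ _)]
    simp only [density, map_add, mul_add, add_mul]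
  map_smul' c g := by
    rw [RingHom.id_apply, ← intervalIntegral.integral_smul]
    simp only [density, map_smul, mul_smul_comm, smul_mul_assoc]

lemma shift_apply (α β : ℝ) (g : C(UnitAddCircle, ℂ)) :
    p.shift α β g = ∫ s in α..β, p.density g s := rfl

lemma density_star (he : Orthonormal ℂ e) (hl : Summable lam) (g : C(UnitAddCircle, ℂ)) (s : ℝ) :
    p.density (star g) s = (starRingEnd ℂ) (p.density g s) := by
  rw [density, density, ← traceForm_star he hl, map_star]
  simp only [star_mul, star_star, mul_assoc]

lemma norm_density_le (he : Orthonormal ℂ e) (hl : Summable lam) (g : C(UnitAddCircle, ℂ))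
    {s M : ℝ} (hM : ‖p.A s‖ ≤ M) : ‖p.density g s‖ ≤ (∑' j, |lam j|) * M ^ 2 * ‖g‖ := by
  refine (norm_traceForm_le he hl _).trans ?_
  have h0 : 0 ≤ ∑' j, |lam j| := tsum_nonneg fun _ => abs_nonneg _
  have hM0 := (norm_nonneg _).trans hM
  refine (mul_le_mul_of_nonneg_left ?_ h0).trans_eq (mul_assoc _ (M ^ 2) ‖g‖).symm
  calc _ ≤ ‖star (p.A s)‖ * ‖unitCalc (p.u s) g‖ * ‖p.A s‖ :=
        (norm_mul_le _ _).trans (mul_le_mul_of_nonneg_right (norm_mul_le _ _) (norm_nonneg _))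
    _ ≤ M * ‖g‖ * M := by
        rw [norm_star]
        have := norm_unitCalc_le (p.u s) g
        gcongr
    _ = M ^ 2 * ‖g‖ := by ring

lemma norm_shift_le (he : Orthonormal ℂ e) (hl : Summable lam) {M : ℝ} {α β : ℝ}
    (hM : ∀ s ∈ uIoc α β, ‖p.A s‖ ≤ M) (g : C(UnitAddCircle, ℂ)) :
    ‖p.shift α β g‖ ≤ (∑' j, |lam j|) * M ^ 2 * |β - α| * ‖g‖ := by
  refine (intervalIntegral.norm_integral_le_of_norm_le_const
    fun s hs => p.norm_density_le he hl g (hM s hs)).trans (le_of_eq ?_)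
  ring

lemma hasSum_inner_pow_sub (he : Orthonormal ℂ e) (hl : Summable lam) {κ : Type*}
    (b : HilbertBasis κ ℂ 𝓗) (n : ℕ) (s t : ℝ) :
    HasSum (fun i => ⟪b i, ((p.u t : 𝓗 →L[ℂ] 𝓗) ^ n - (p.u s : 𝓗 →L[ℂ] 𝓗) ^ n) (b i)⟫_ℂ)
      ((p.q t - p.q s) * ∑ j ∈ Finset.range n, traceForm e lam
        (star (p.A s) * (p.u s : 𝓗 →L[ℂ] 𝓗) ^ (n - 1 - j) *
          ((p.u t : 𝓗 →L[ℂ] 𝓗) ^ j * p.G t))) := by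
  have h := (hasSum_sum fun j (_ : j ∈ Finset.range n) => hasSum_inner_mul_diagOp_mul b he hl
    ((p.u t : 𝓗 →L[ℂ] 𝓗) ^ j * p.G t)
    (star (p.A s) * (p.u s : 𝓗 →L[ℂ] 𝓗) ^ (n - 1 - j))).mul_left (p.q t - p.q s)
  refine h.congr_fun fun i => ?_
  rw [pow_sub_pow_eq_sum, p.sub_eq s t, ← inner_sum, ← inner_smul_right, ← sum_apply, ← smul_apply,
    Finset.smul_sum]
  congr 2
  refine Finset.sum_congr rfl fun j _ => ?_
  simp only [mul_smul_comm, smul_mul_assoc, mul_assoc]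

lemma hasShift (he : Orthonormal ℂ e) (hl : Summable lam) (α β : ℝ) :
    HasShift (p.u α : 𝓗 →L[ℂ] 𝓗) (p.u β) (p.shift α β) := by
  constructor
  · intro g
    rw [shift_apply, shift_apply]
    simp_rw [p.density_star he hl]
    exact intervalIntegral.intervalIntegral_conj
  · intro κ b n hn
    set τ : ℝ → ℝ → ℂ := fun s t => (p.q t - p.q s) * ∑ j ∈ Finset.range n, traceForm e lam
        (star (p.A s) * (p.u s : 𝓗 →L[ℂ] 𝓗) ^ (n - 1 - j) *
          ((p.u t : 𝓗 →L[ℂ] 𝓗) ^ j * p.G t)) with hτ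
    have hsum := fun s t => p.hasSum_inner_pow_sub he hl b n s t
    have hadd : ∀ s t, τ α t = τ α s + τ s t := fun s t => by
      refine (hsum α t).unique (((hsum α s).add (hsum s t)).congr_fun fun i => ?_)
      rw [← inner_add_right, ← add_apply]
      congr 2
      abel
    have hder : ∀ s, HasDerivAt (τ α) (I * n * p.density (fourier (n : ℤ)) s) s := fun s => by
      have hc : Continuous fun t => ∑ j ∈ Finset.range n, traceForm e lam
        (star (p.A s) * (p.u s : 𝓗 →L[ℂ] 𝓗) ^ (n - 1 - j) *
          ((p.u t : 𝓗 →L[ℂ] 𝓗) ^ j * p.G t)) := by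
        have h1 : Continuous fun t => (p.u t : 𝓗 →L[ℂ] 𝓗) :=
          continuous_subtype_val.comp p.continuous_u
        have h2 := p.continuous_G
        fun_prop
      have h := (hasDerivAt_sub_mul (p.hasDerivAt_q s) hc.continuousAt).const_add (τ α s)
      have hfun : τ α = fun t => τ α s + τ s t := funext (hadd s)
      rw [hfun]
      refine h.congr_deriv ?_
      rw [Finset.mul_sum]
      have hterm : ∀ j ∈ Finset.range n, p.q' s * traceForm e lam
          (star (p.A s) * (p.u s : 𝓗 →L[ℂ] 𝓗) ^ (n - 1 - j) *
          ((p.u s : 𝓗 →L[ℂ] 𝓗) ^ j * p.G s)) = I * p.density (fourier (n : ℤ)) s := fun j hj => by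
        have hj := Finset.mem_range.1 hj
        rw [← smul_eq_mul (p.q' s), ← map_smul, density, ← smul_eq_mul I, ← map_smul,
          ← mul_smul_comm, ← mul_smul_comm, p.deriv_eq, unitCalc_fourier_natCast]
        simp only [mul_smul_comm]
        congr 2
        have : n = (n - 1 - j) + (j + 1) := by omega
        conv_rhs => rw [this, pow_add, pow_succ]
        simp only [mul_assoc]
      rw [Finset.sum_congr rfl hterm]
      simp
      ring
    have hInt := intervalIntegral.integral_eq_sub_of_hasDerivAt (a := α) (b := β)
      (fun s _ => hder s)
      ((continuous_const.mul (p.continuous_density _)).intervalIntegrable _ _)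
    have h0 : τ α α = 0 := by simp [hτ]
    rw [h0, sub_zero, intervalIntegral.integral_const_mul] at hInt
    rw [shift_apply, hInt]
    exact hsum α β

end UnitaryPath

lemma eq_mul_integral_of_fourier_eq_zero (L : C(UnitAddCircle, ℂ) →ₗ[ℂ] ℂ) {C : ℝ}
    (hC : ∀ g, ‖L g‖ ≤ C * ‖g‖) (h : ∀ n : ℤ, n ≠ 0 → L (fourier n) = 0)
    (g : C(UnitAddCircle, ℂ)) : L g = L 1 * ∫ x, g x ∂AddCircle.haarAddCircle := by
  let L₁ : C(UnitAddCircle, ℂ) →L[ℂ] ℂ := L.mkContinuous C hC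
  let J : C(UnitAddCircle, ℂ) →L[ℂ] ℂ := LinearMap.mkContinuous
    { toFun := fun g => ∫ x, g x ∂AddCircle.haarAddCircle
      map_add' := fun g g' => integral_add (g.continuous.integrable_of_hasCompactSupport
        (HasCompactSupport.of_compactSpace _)) (g'.continuous.integrable_of_hasCompactSupport
        (HasCompactSupport.of_compactSpace _))
      map_smul' := fun c g => integral_const_mul c _ } 1 fun g => by
        refine (norm_integral_le_of_norm_le_const (.of_forall g.norm_coe_le_norm)).trans ?_
        simp
  have hdense : Dense (Submodule.span ℂ (Set.range (fourier (T := (1 : ℝ)))) :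
      Set C(UnitAddCircle, ℂ)) := by
    rw [Submodule.dense_iff_topologicalClosure_eq_top]
    exact span_fourier_closure_eq_top
  have : L₁ = L 1 • J := by
    refine ContinuousLinearMap.ext_on hdense ?_
    rintro _ ⟨n, rfl⟩
    change L (fourier n) = L 1 * ∫ x, (fourier n : C(UnitAddCircle, ℂ)) x ∂AddCircle.haarAddCircle
    by_cases h0 : n = 0
    · subst h0
      have : (fourier 0 : C(UnitAddCircle, ℂ)) = 1 := by ext; simp
      simp [this]
    · rw [h n h0]
      have : ∫ x, (fourier n : C(UnitAddCircle, ℂ)) x ∂AddCircle.haarAddCircle = 0 :=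
        integral_eq_zero_of_add_right_eq_neg (fourier_add_half_inv_index h0 one_pos)
      rw [this, mul_zero]
  exact DFunLike.congr_fun this g

section unitCalcPositivity

variable (u : unitary (𝓗 →L[ℂ] 𝓗)) (x : 𝓗)

/-- A real-valued continuous function viewed as a complex-valued one. -/
def realToComplex {X : Type*} [TopologicalSpace X] (k : C(X, ℝ)) : C(X, ℂ) :=
  ⟨fun y => (k y : ℂ), Complex.continuous_ofReal.comp k.continuous⟩

/-- The pointwise norm of a continuous function, as a complex-valued function. -/
def normFun {X : Type*} [TopologicalSpace X] (g : C(X, ℂ)) : C(X, ℂ) :=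
  realToComplex ⟨fun y => ‖g y‖, g.continuous.norm⟩

lemma re_inner_unitCalc_nonneg {k : C(UnitAddCircle, ℝ)} (hk : ∀ y, 0 ≤ k y) :
    0 ≤ (⟪x, unitCalc u (realToComplex k) x⟫_ℂ).re := by
  let h : C(UnitAddCircle, ℂ) := realToComplex ⟨fun y => √(k y), k.continuous.sqrt⟩
  have hh : realToComplex k = star h * h := by
    ext y
    change (k y : ℂ) = (starRingEnd ℂ) ((√(k y) : ℝ) : ℂ) * ((√(k y) : ℝ) : ℂ)
    rw [Complex.conj_ofReal, ← Complex.ofReal_mul, Real.mul_self_sqrt (hk y)]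
  rw [hh, map_mul, map_star, mul_apply_eq_comp, ContinuousLinearMap.star_eq_adjoint,
    ContinuousLinearMap.adjoint_inner_right]
  exact inner_self_nonneg (𝕜 := ℂ)

lemma norm_inner_unitCalc_le (g : C(UnitAddCircle, ℂ)) :
    ‖⟪x, unitCalc u g x⟫_ℂ‖ ≤ (⟪x, unitCalc u (normFun g) x⟫_ℂ).re := by
  obtain ⟨c, hc, hcg⟩ := Complex.exists_norm_mul_eq_self ⟪x, unitCalc u g x⟫_ℂ
  set a := ⟪x, unitCalc u g x⟫_ℂ with ha
  have hc' : (starRingEnd ℂ) c * c = 1 := by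
    rw [← Complex.normSq_eq_conj_mul_self, Complex.normSq_eq_norm_sq, hc]; simp
  let k : C(UnitAddCircle, ℝ) := ⟨fun y => ‖g y‖ - ((starRingEnd ℂ) c * g y).re,
    g.continuous.norm.sub (Complex.continuous_re.comp (continuous_const.mul g.continuous))⟩
  have hk : ∀ y, 0 ≤ k y := fun y => by
    have := Complex.re_le_norm ((starRingEnd ℂ) c * g y)
    rw [norm_mul, RCLike.norm_conj, hc, one_mul] at this
    exact sub_nonneg.2 this
  have hke : realToComplex k = normFun g
      - ((1 / 2 : ℂ) * (starRingEnd ℂ) c) • g - ((1 / 2 : ℂ) * c) • star g := by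
    ext y
    change (((‖g y‖ - ((starRingEnd ℂ) c * g y).re : ℝ)) : ℂ) = ((‖g y‖ : ℝ) : ℂ)
      - ((1 / 2 : ℂ) * (starRingEnd ℂ) c) * g y - ((1 / 2 : ℂ) * c) * (starRingEnd ℂ) (g y)
    push_cast
    rw [Complex.re_eq_add_conj, map_mul, Complex.conj_conj]
    ring
  have h := re_inner_unitCalc_nonneg u x hk
  have hstar : ⟪x, unitCalc u (star g) x⟫_ℂ = (starRingEnd ℂ) a := by
    rw [map_star, ContinuousLinearMap.star_eq_adjoint, ContinuousLinearMap.adjoint_inner_right,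
      ha, inner_conj_symm]
  rw [hke, map_sub, map_sub, map_smul, map_smul, sub_apply, sub_apply, smul_apply, smul_apply,
    inner_sub_right, inner_sub_right, inner_smul_right, inner_smul_right, hstar, ← ha] at h
  have h1 : (1 / 2 : ℂ) * (starRingEnd ℂ) c * a = ((‖a‖ / 2 : ℝ) : ℂ) := by
    rw [← hcg, norm_mul, hc, one_mul, Complex.norm_real, norm_norm]
    push_cast
    linear_combination (‖a‖ / 2 : ℂ) * hc'
  have h2 : (1 / 2 : ℂ) * c * (starRingEnd ℂ) a = ((‖a‖ / 2 : ℝ) : ℂ) := by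
    rw [← Complex.conj_ofReal, ← h1]
    simp [map_ofNat (starRingEnd ℂ) 2]
  rw [h1, h2, Complex.sub_re, Complex.sub_re, Complex.ofReal_re] at h
  linarith

end unitCalcPositivity

section shift

variable {U U' U'' : 𝓗 →L[ℂ] 𝓗}

lemma HasShift.sub_apply {L L' : C(UnitAddCircle, ℂ) →ₗ[ℂ] ℂ} (h : HasShift U U' L)
    (h' : HasShift U U' L') {C C' : ℝ} (hC : ∀ g, ‖L g‖ ≤ C * ‖g‖) (hC' : ∀ g, ‖L' g‖ ≤ C' * ‖g‖)
    (g : C(UnitAddCircle, ℂ)) :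
    L g - L' g = (L 1 - L' 1) * ∫ x, g x ∂AddCircle.haarAddCircle := by
  obtain ⟨κ, b, -⟩ := exists_hilbertBasis ℂ 𝓗
  have hnat : ∀ n : ℕ, 1 ≤ n → (L - L') (fourier (n : ℤ)) = 0 := fun n hn => by
    have := (h.2 κ b n hn).unique (h'.2 κ b n hn)
    have hn0 : (I * n : ℂ) ≠ 0 := mul_ne_zero I_ne_zero (Nat.cast_ne_zero.2 (by omega))
    rw [LinearMap.sub_apply, mul_left_cancel₀ hn0 this, sub_self]
  refine eq_mul_integral_of_fourier_eq_zero (L - L') (C := C + C') (fun g => ?_) (fun n hn => ?_) g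
  · rw [LinearMap.sub_apply, add_mul]
    exact (norm_sub_le _ _).trans (add_le_add (hC g) (hC' g))
  · obtain ⟨m, rfl | rfl⟩ := n.eq_nat_or_neg
    · exact hnat m (by omega)
    · have : (fourier (-(m : ℤ)) : C(UnitAddCircle, ℂ)) = star (fourier (m : ℤ)) := by
        ext y
        exact fourier_neg
      rw [this, LinearMap.sub_apply, h.1, h'.1, ← map_sub, ← LinearMap.sub_apply,
        hnat m (by omega), map_zero]

/-- The difference of traces is represented by a functional that is dominated by
`C ∫ |g| + ε ‖g‖`. -/
def ShiftBound (C ε : ℝ) (U U' : 𝓗 →L[ℂ] 𝓗) : Prop :=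
  ∃ L, HasShift U U' L ∧ ∀ g : C(UnitAddCircle, ℂ),
    ‖L g‖ ≤ C * (∫ x, ‖g x‖ ∂AddCircle.haarAddCircle) + ε * ‖g‖

lemma integral_norm_le (g : C(UnitAddCircle, ℂ)) :
    ∫ x, ‖g x‖ ∂AddCircle.haarAddCircle ≤ ‖g‖ := by
  have h := norm_integral_le_of_norm_le_const (μ := AddCircle.haarAddCircle)
    (f := fun x => ‖g x‖) (C := ‖g‖) (.of_forall fun x => by simpa using g.norm_coe_le_norm x)
  have h0 : 0 ≤ ∫ x, ‖g x‖ ∂AddCircle.haarAddCircle := integral_nonneg fun _ => norm_nonneg _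
  rw [Real.norm_of_nonneg h0] at h
  simpa using h

lemma HasShift.trans {L L' : C(UnitAddCircle, ℂ) →ₗ[ℂ] ℂ} (h : HasShift U U' L)
    (h' : HasShift U' U'' L') : HasShift U U'' (L + L') := by
  refine ⟨fun g => by rw [LinearMap.add_apply, LinearMap.add_apply, h.1, h'.1, map_add],
    fun κ b n hn => ?_⟩
  rw [LinearMap.add_apply, mul_add]
  refine ((h.2 κ b n hn).add (h'.2 κ b n hn)).congr_fun fun i => ?_
  rw [← inner_add_right, ← _root_.add_apply]
  congr 2
  abel

lemma HasShift.refl (U : 𝓗 →L[ℂ] 𝓗) : HasShift U U 0 :=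
  ⟨fun g => by simp, fun κ b n _ => by simp [hasSum_zero]⟩

lemma ShiftBound.trans {C C' ε ε' : ℝ} (h : ShiftBound C ε U U') (h' : ShiftBound C' ε' U' U'') :
    ShiftBound (C + C') (ε + ε') U U'' := by
  obtain ⟨L, hL, hb⟩ := h
  obtain ⟨L', hL', hb'⟩ := h'
  refine ⟨L + L', hL.trans hL', fun g => ?_⟩
  rw [LinearMap.add_apply]
  refine (norm_add_le _ _).trans ((add_le_add (hb g) (hb' g)).trans (le_of_eq ?_))
  ring

lemma ShiftBound.norm_le {C ε : ℝ} (hC : 0 ≤ C) (h : ShiftBound C ε U U')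
    {L : C(UnitAddCircle, ℂ) →ₗ[ℂ] ℂ} (hL : HasShift U U' L) {M : ℝ} (hM : ∀ g, ‖L g‖ ≤ M * ‖g‖) :
    ∃ C' : ℝ, ∀ g, ‖L g‖ ≤ C' * (∫ x, ‖g x‖ ∂AddCircle.haarAddCircle) + ε * ‖g‖ := by
  obtain ⟨L', hL', hb⟩ := h
  have hb' : ∀ g, ‖L' g‖ ≤ (C + ε) * ‖g‖ := fun g => by
    refine (hb g).trans ?_
    rw [add_mul]
    gcongr
    exact integral_norm_le g
  refine ⟨C + ‖L 1 - L' 1‖, fun g => ?_⟩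
  have h := hL.sub_apply hL' hM hb' g
  have h1 : L g = L' g + (L 1 - L' 1) * ∫ x, g x ∂AddCircle.haarAddCircle := by
    rw [← h]; ring
  rw [h1]
  refine (norm_add_le _ _).trans ?_
  rw [norm_mul]
  have := norm_integral_le_integral_norm (μ := AddCircle.haarAddCircle) (fun x => g x)
  have := mul_le_mul_of_nonneg_left this (norm_nonneg (L 1 - L' 1))
  linarith [hb g]

end shift

section rankOne

/-- The projection onto the line spanned by a unit vector. -/
abbrev lineProj (x : 𝓗) : 𝓗 →L[ℂ] 𝓗 := InnerProductSpace.rankOne ℂ x x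

variable {x : 𝓗}

lemma lineProj_mul_self (hx : ‖x‖ = 1) : lineProj x * lineProj x = lineProj x := by
  ext y
  simp [InnerProductSpace.rankOne_apply, inner_self_eq_norm_sq_to_K, hx]

lemma star_lineProj (x : 𝓗) : star (lineProj x) = lineProj x := by
  rw [ContinuousLinearMap.star_eq_adjoint, InnerProductSpace.adjoint_rankOne]

lemma diagOp_unit (x : 𝓗) : diagOp (fun _ : Unit => x) (fun _ => 1) = lineProj x := by
  simp [diagOp, lineProj]

lemma one_add_smul_lineProj_mul (hx : ‖x‖ = 1) (a b : ℂ) :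
    (1 + (a - 1) • lineProj x) * (1 + (b - 1) • lineProj x)
      = 1 + (a * b - 1) • lineProj x := by
  simp only [add_mul, mul_add, one_mul, mul_one, smul_mul_smul_comm, lineProj_mul_self hx]
  module

/-- The unitary which multiplies the unit vector `x` by `w` and fixes its orthogonal complement. -/
def lineRot (hx : ‖x‖ = 1) {w : ℂ} (hw : ‖w‖ = 1) : unitary (𝓗 →L[ℂ] 𝓗) :=
  ⟨1 + (w - 1) • lineProj x, by
    have hs : star (1 + (w - 1) • lineProj x) = 1 + ((starRingEnd ℂ) w - 1) • lineProj x := by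
      rw [star_add, star_one, star_smul, star_lineProj]
      congr 2
      simp
    have h1 : (starRingEnd ℂ) w * w = 1 := by
      rw [← Complex.normSq_eq_conj_mul_self, Complex.normSq_eq_norm_sq, hw]; simp
    rw [Unitary.mem_iff, hs, one_add_smul_lineProj_mul hx, one_add_smul_lineProj_mul hx,
      mul_comm w, h1]
    simp⟩

lemma coe_lineRot (hx : ‖x‖ = 1) {w : ℂ} (hw : ‖w‖ = 1) :
    (lineRot hx hw : 𝓗 →L[ℂ] 𝓗) = 1 + (w - 1) • lineProj x := rfl

/-- The path of rotations of a line. -/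
def linePath (u : unitary (𝓗 →L[ℂ] 𝓗)) (hx : ‖x‖ = 1) :
    UnitaryPath (fun _ : Unit => x) (fun _ => 1) where
  u t := u * lineRot hx (Complex.norm_exp_ofReal_mul_I t)
  A _ := 1
  G t := exp (-(t * I)) • ((u * lineRot hx (Complex.norm_exp_ofReal_mul_I t) :
    unitary (𝓗 →L[ℂ] 𝓗)) : 𝓗 →L[ℂ] 𝓗)
  q t := exp (t * I)
  q' t := exp (t * I) * I
  continuous_u := by
    refine Continuous.subtype_mk (f := fun t : ℝ => (u : 𝓗 →L[ℂ] 𝓗) *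
      (1 + (exp (t * I) - 1) • lineProj x)) ?_ _
    fun_prop
  continuous_A := continuous_const
  continuous_G := by
    change Continuous fun t : ℝ => exp (-(t * I)) • ((u : 𝓗 →L[ℂ] 𝓗) *
      (1 + (exp (t * I) - 1) • lineProj x))
    fun_prop
  hasDerivAt_q t := by
    have h : HasDerivAt (fun t : ℝ => (t : ℂ) * I) (1 * I) t :=
      (Complex.ofRealCLM.hasDerivAt (x := t)).mul_const I
    simpa using h.cexp
  sub_eq s t := by
    rw [diagOp_unit, star_one, mul_one, Submonoid.coe_mul, Submonoid.coe_mul, coe_lineRot,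
      coe_lineRot, smul_mul_assoc, smul_smul, ← mul_sub, mul_assoc]
    have h1 : (1 + (exp (t * I) - 1) • lineProj x) * lineProj x = exp (t * I) • lineProj x := by
      rw [add_mul, one_mul, smul_mul_assoc, lineProj_mul_self hx]
      module
    rw [h1, mul_smul_comm, smul_smul, mul_assoc, ← Complex.exp_add, neg_add_cancel,
      Complex.exp_zero, mul_one, ← mul_smul_comm]
    congr 1
    module
  deriv_eq s := by
    rw [mul_one, smul_smul, mul_right_comm, ← Complex.exp_add, add_neg_cancel, Complex.exp_zero,
      one_mul]

lemma density_linePath (u : unitary (𝓗 →L[ℂ] 𝓗)) (hx : ‖x‖ = 1) (g : C(UnitAddCircle, ℂ))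
    (t : ℝ) : (linePath u hx).density g t = ⟪x, unitCalc ((linePath u hx).u t) g x⟫_ℂ := by
  simp [UnitaryPath.density, linePath, traceForm]

lemma orthonormal_unit (hx : ‖x‖ = 1) : Orthonormal ℂ (fun _ : Unit => x) :=
  ⟨fun _ => hx, fun _ _ h => (h rfl).elim⟩

lemma exists_shiftBound_lineRot (u : unitary (𝓗 →L[ℂ] 𝓗)) (hx : ‖x‖ = 1) {w : ℂ}
    (hw : ‖w‖ = 1) :
    ∃ C, 0 ≤ C ∧ ShiftBound C 0 (u : 𝓗 →L[ℂ] 𝓗) ((u * lineRot hx hw : unitary (𝓗 →L[ℂ] 𝓗))) := by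
  set p := linePath u hx with hp
  have he := orthonormal_unit hx
  have hl : Summable fun _ : Unit => (1 : ℝ) := (hasSum_fintype _).summable
  have hpu : ∀ t : ℝ, (p.u t : 𝓗 →L[ℂ] 𝓗) = u * (1 + (exp (t * I) - 1) • lineProj x) :=
    fun _ => rfl
  have h0 : (p.u 0 : 𝓗 →L[ℂ] 𝓗) = u := by simp [hpu]
  have hθ : (p.u (arg w) : 𝓗 →L[ℂ] 𝓗) = (u * lineRot hx hw : unitary (𝓗 →L[ℂ] 𝓗)) := by
    rw [hpu]
    have : exp (arg w * I) = w := by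
      have := Complex.norm_mul_exp_arg_mul_I w
      rwa [hw, Complex.ofReal_one, one_mul] at this
    rw [this]
    rfl
  have hA : ∀ s, ‖p.A s‖ ≤ 1 := fun s => by
    rw [show p.A s = 1 from rfl]
    exact ContinuousLinearMap.norm_id_le
  have hloop : (p.u π : 𝓗 →L[ℂ] 𝓗) = p.u (-π) := by
    rw [hpu, hpu]
    simp [Complex.exp_neg, Complex.exp_pi_mul_I]
  have hL := p.hasShift he hl (-π) π
  rw [hloop] at hL
  have hfull := fun g => hL.sub_apply (HasShift.refl _) (p.norm_shift_le he hl fun s _ => hA s)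
    (C' := 0) (fun g => by simp) g
  simp only [LinearMap.zero_apply, sub_zero] at hfull
  refine ⟨‖p.shift (-π) π 1‖, norm_nonneg _, p.shift 0 (arg w), ?_, fun g => ?_⟩
  · have := p.hasShift he hl 0 (arg w)
    rwa [h0, hθ] at this
  · have hcont := (p.continuous_density g).norm
    have hcont' := p.continuous_density (normFun g)
    have hsub : uIoc 0 (arg w) ⊆ Ioc (-π) π := by
      intro s hs
      rw [uIoc, mem_Ioc] at hs
      have h1 := Complex.neg_pi_lt_arg w
      have h2 := Complex.arg_le_pi w
      refine ⟨lt_of_le_of_lt ?_ hs.1, hs.2.trans ?_⟩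
      · exact le_min (by linarith [Real.pi_pos]) h1.le
      · exact max_le Real.pi_pos.le h2
    have hππ : -π ≤ π := by linarith [Real.pi_pos]
    calc ‖p.shift 0 (arg w) g‖ ≤ ∫ s in uIoc 0 (arg w), ‖p.density g s‖ :=
          intervalIntegral.norm_integral_le_integral_norm_uIoc
      _ ≤ ∫ s in Ioc (-π) π, ‖p.density g s‖ := by
          refine setIntegral_mono_set ?_ (.of_forall fun _ => norm_nonneg _) hsub.eventuallyLE
          exact (hcont.intervalIntegrable (-π) π).1
      _ = ∫ s in (-π)..π, ‖p.density g s‖ := (intervalIntegral.integral_of_le hππ).symm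
      _ ≤ ∫ s in (-π)..π, (p.density (normFun g) s).re := by
          refine intervalIntegral.integral_mono_on hππ (hcont.intervalIntegrable _ _)
            ((Complex.continuous_re.comp hcont').intervalIntegrable _ _) fun s _ => ?_
          rw [hp, density_linePath, density_linePath]
          exact norm_inner_unitCalc_le _ _ _
      _ = (p.shift (-π) π (normFun g)).re := by
          rw [UnitaryPath.shift_apply]
          exact Complex.reCLM.intervalIntegral_comp_comm (hcont'.intervalIntegrable _ _)
      _ ≤ ‖p.shift (-π) π (normFun g)‖ := Complex.re_le_norm _
      _ = ‖p.shift (-π) π 1‖ * (∫ y, ‖g y‖ ∂AddCircle.haarAddCircle) + 0 * ‖g‖ := by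
          rw [hfull, norm_mul, zero_mul, add_zero]
          congr 1
          have : ∫ y, (normFun g) y ∂AddCircle.haarAddCircle
              = ((∫ y, ‖g y‖ ∂AddCircle.haarAddCircle : ℝ) : ℂ) := integral_ofReal
          rw [this, Complex.norm_real, Real.norm_of_nonneg (integral_nonneg fun _ => norm_nonneg _)]

end rankOne

section cayley

variable {a b : 𝓗 →L[ℂ] 𝓗}

lemma isUnit_one_sub_I_smul (ha : IsSelfAdjoint a) : IsUnit (1 - I • a) := by
  have h : -I ∉ spectrum ℂ a := fun h => by
    have := ha.im_eq_zero_of_mem_spectrum h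
    simp at this
  rw [spectrum.notMem_iff] at h
  have h2 := h.smul (Units.mk0 I I_ne_zero)
  rw [Units.smul_mk0, smul_sub, Algebra.algebraMap_eq_smul_one, smul_smul] at h2
  simpa using h2

/-- The inverse of `1 - i a`. -/
def cayInv (a : 𝓗 →L[ℂ] 𝓗) : 𝓗 →L[ℂ] 𝓗 := Ring.inverse (1 - I • a)

lemma cayInv_mul (ha : IsSelfAdjoint a) : cayInv a * (1 - I • a) = 1 :=
  Ring.inverse_mul_cancel _ (isUnit_one_sub_I_smul ha)

lemma mul_cayInv (ha : IsSelfAdjoint a) : (1 - I • a) * cayInv a = 1 :=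
  Ring.mul_inverse_cancel _ (isUnit_one_sub_I_smul ha)

lemma eq_cayInv (ha : IsSelfAdjoint a) (h : (1 - I • a) * b = 1) : b = cayInv a := by
  rw [← one_mul b, ← cayInv_mul ha, mul_assoc, h, mul_one]

lemma cayInv_sub_cayInv (ha : IsSelfAdjoint a) (hb : IsSelfAdjoint b) :
    cayInv a - cayInv b = I • (cayInv a * (a - b) * cayInv b) := by
  have h : I • (cayInv a * (a - b) * cayInv b)
      = cayInv a * ((1 - I • b) - (1 - I • a)) * cayInv b := by
    rw [sub_sub_sub_cancel_left, ← smul_sub, mul_smul_comm, smul_mul_assoc]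
  rw [h, mul_sub, sub_mul, mul_assoc, mul_cayInv hb, cayInv_mul ha, mul_one, one_mul]

lemma star_one_sub_I_smul (ha : IsSelfAdjoint a) : star (1 - I • a) = 1 + I • a := by
  rw [star_sub, star_one, star_smul, ha.star_eq, ← starRingEnd_apply, Complex.conj_I, neg_smul,
    sub_neg_eq_add]

lemma two_smul_cayInv_sub_one (ha : IsSelfAdjoint a) :
    (2 : ℂ) • cayInv a - 1 = (1 + I • a) * cayInv a := by
  have : (1 + I • a) = (2 : ℂ) • (1 : 𝓗 →L[ℂ] 𝓗) - (1 - I • a) := by module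
  rw [this, sub_mul, mul_cayInv ha, smul_mul_assoc, one_mul]

/-- The Cayley transform `(1 + i a) (1 - i a)⁻¹` of a self-adjoint operator. -/
def cayley (ha : IsSelfAdjoint a) : unitary (𝓗 →L[ℂ] 𝓗) :=
  ⟨(2 : ℂ) • cayInv a - 1, by
    have hs := star_one_sub_I_smul ha
    have hcomm : (1 + I • a) * (1 - I • a) = (1 - I • a) * (1 + I • a) := by
      simp only [add_mul, mul_add, mul_sub, sub_mul, one_mul, mul_one]
      abel
    have hs' : star (1 + I • a) = 1 - I • a := by rw [← hs, star_star]
    have hc : (1 + I • a) * cayInv a = cayInv a * (1 + I • a) := by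
      calc _ = cayInv a * (1 - I • a) * ((1 + I • a) * cayInv a) := by rw [cayInv_mul ha, one_mul]
        _ = cayInv a * ((1 - I • a) * (1 + I • a)) * cayInv a := by simp only [mul_assoc]
        _ = cayInv a * (1 + I • a) * ((1 - I • a) * cayInv a) := by
            rw [← hcomm]; simp only [mul_assoc]
        _ = _ := by rw [mul_cayInv ha, mul_one]
    have h1 : star (cayInv a) * (1 + I • a) = 1 := by
      rw [← hs, ← star_mul, mul_cayInv ha, star_one]
    have h2 : (1 + I • a) * star (cayInv a) = 1 := by
      rw [← hs, ← star_mul, cayInv_mul ha, star_one]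
    rw [Unitary.mem_iff, two_smul_cayInv_sub_one ha]
    constructor
    · rw [star_mul, hs']
      calc _ = star (cayInv a) * ((1 - I • a) * (1 + I • a)) * cayInv a := by
            simp only [mul_assoc]
        _ = star (cayInv a) * (1 + I • a) * ((1 - I • a) * cayInv a) := by
            rw [← hcomm]; simp only [mul_assoc]
        _ = 1 := by rw [h1, mul_cayInv ha, one_mul]
    · rw [star_mul, hs', hc]
      calc _ = cayInv a * (((1 + I • a) * star (cayInv a)) * (1 - I • a)) := by
            simp only [mul_assoc]
        _ = 1 := by rw [h2, one_mul, cayInv_mul ha]⟩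

lemma coe_cayley (ha : IsSelfAdjoint a) : (cayley ha : 𝓗 →L[ℂ] 𝓗) = (2 : ℂ) • cayInv a - 1 := rfl

lemma cayley_mul_star_cayInv (ha : IsSelfAdjoint a) :
    (cayley ha : 𝓗 →L[ℂ] 𝓗) * star (cayInv a) = cayInv a := by
  have h2 : (1 + I • a) * star (cayInv a) = 1 := by
    rw [← star_one_sub_I_smul ha, ← star_mul, cayInv_mul ha, star_one]
  have h3 : ((2 : ℂ) • cayInv a - 1) * (1 - I • a) = 1 + I • a := by
    rw [sub_mul, smul_mul_assoc, cayInv_mul ha, one_mul]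
    module
  rw [coe_cayley]
  refine eq_cayInv ha ?_
  have hc : Commute (1 - I • a) (cayInv a) := by
    rw [Commute, SemiconjBy, cayInv_mul ha, mul_cayInv ha]
  have hc' : Commute (1 - I • a) ((2 : ℂ) • cayInv a - 1) :=
    (hc.smul_right 2).sub_right (Commute.one_right _)
  calc (1 - I • a) * (((2 : ℂ) • cayInv a - 1) * star (cayInv a))
      = ((2 : ℂ) • cayInv a - 1) * (1 - I • a) * star (cayInv a) := by
        rw [← mul_assoc, hc'.eq]
    _ = 1 := by rw [h3, h2]

lemma norm_cayInv_le (ha : IsSelfAdjoint a) : ‖cayInv a‖ ≤ 1 := by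
  have h : cayInv a = (1 / 2 : ℂ) • ((cayley ha : 𝓗 →L[ℂ] 𝓗) + 1) := by
    rw [coe_cayley]
    module
  have h2 : ‖(1 : 𝓗 →L[ℂ] 𝓗)‖ ≤ 1 := ContinuousLinearMap.norm_id_le
  have h1 : ‖(cayley ha : 𝓗 →L[ℂ] 𝓗)‖ ≤ 1 := by
    have h : ‖(cayley ha : 𝓗 →L[ℂ] 𝓗) * (1 : 𝓗 →L[ℂ] 𝓗)‖ = ‖(1 : 𝓗 →L[ℂ] 𝓗)‖ :=
      CStarRing.norm_coe_unitary_mul _ _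
    rw [mul_one] at h
    rw [h]
    exact h2
  rw [h, norm_smul]
  have h3 := norm_add_le (cayley ha : 𝓗 →L[ℂ] 𝓗) 1
  norm_num
  linarith

lemma continuous_cayInv {X : Type*} [TopologicalSpace X] {f : X → 𝓗 →L[ℂ] 𝓗}
    (hf : Continuous f) (hsa : ∀ t, IsSelfAdjoint (f t)) : Continuous fun t => cayInv (f t) := by
  rw [continuous_iff_continuousAt]
  intro t
  obtain ⟨v, hv⟩ := isUnit_one_sub_I_smul (hsa t)
  have h1 := NormedRing.inverse_continuousAt v
  rw [hv] at h1
  exact ContinuousAt.comp (f := fun t => 1 - I • f t) h1 (by fun_prop)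

end cayley

section cayleyPath

variable {ι : Type*} {e : ι → 𝓗} {lam : ι → ℝ}

lemma isSelfAdjoint_ofReal_smul {K : 𝓗 →L[ℂ] 𝓗} (hK : IsSelfAdjoint K) (t : ℝ) :
    IsSelfAdjoint ((t : ℂ) • K) := by
  rw [IsSelfAdjoint, star_smul, hK.star_eq, ← starRingEnd_apply, Complex.conj_ofReal]

/-- The path of Cayley transforms of the multiples of a self-adjoint trace class operator. -/
def cayleyPath (u : unitary (𝓗 →L[ℂ] 𝓗)) (e : ι → 𝓗) (lam : ι → ℝ) : UnitaryPath e lam where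
  u t := u * cayley (isSelfAdjoint_ofReal_smul (isSelfAdjoint_diagOp (e := e) (lam := lam)) (t / 2))
  A t := star (cayInv (((t / 2 : ℝ) : ℂ) • diagOp e lam))
  G t := I • ((u : 𝓗 →L[ℂ] 𝓗) * cayInv (((t / 2 : ℝ) : ℂ) • diagOp e lam))
  q t := t
  q' _ := 1
  continuous_u := by
    have h := continuous_cayInv (f := fun t : ℝ => ((t / 2 : ℝ) : ℂ) • diagOp e lam) (by fun_prop)
      (fun t => isSelfAdjoint_ofReal_smul isSelfAdjoint_diagOp _)
    refine Continuous.subtype_mk (f := fun t : ℝ => (u : 𝓗 →L[ℂ] 𝓗) *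
      ((2 : ℂ) • cayInv (((t / 2 : ℝ) : ℂ) • diagOp e lam) - 1)) ?_ _
    fun_prop
  continuous_A := (continuous_cayInv (by fun_prop)
      (fun t => isSelfAdjoint_ofReal_smul isSelfAdjoint_diagOp _)).star
  continuous_G := by
    have h := continuous_cayInv (f := fun t : ℝ => ((t / 2 : ℝ) : ℂ) • diagOp e lam) (by fun_prop)
      (fun t => isSelfAdjoint_ofReal_smul isSelfAdjoint_diagOp _)
    fun_prop
  hasDerivAt_q t := Complex.ofRealCLM.hasDerivAt
  sub_eq s t := by
    rw [Submonoid.coe_mul, Submonoid.coe_mul, coe_cayley, coe_cayley, star_star, ← mul_sub,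
      sub_sub_sub_cancel_right, ← smul_sub, cayInv_sub_cayInv
        (isSelfAdjoint_ofReal_smul isSelfAdjoint_diagOp _)
        (isSelfAdjoint_ofReal_smul isSelfAdjoint_diagOp _), ← sub_smul]
    simp only [mul_smul_comm, smul_mul_assoc, smul_smul, mul_assoc]
    congr 1
    push_cast
    ring
  deriv_eq s := by
    rw [one_smul, Submonoid.coe_mul, mul_assoc, cayley_mul_star_cayInv]

lemma shiftBound_cayley (u : unitary (𝓗 →L[ℂ] 𝓗)) (he : Orthonormal ℂ e) (hl : Summable lam)
    (ha : IsSelfAdjoint ((1 / 2 : ℂ) • diagOp e lam)) :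
    ShiftBound 0 (∑' j, |lam j|) (u : 𝓗 →L[ℂ] 𝓗) ((u * cayley ha : unitary (𝓗 →L[ℂ] 𝓗))) := by
  set p := cayleyPath u e lam with hp
  have hA : ∀ s, ‖p.A s‖ ≤ 1 := fun s => by
    rw [show p.A s = star (cayInv (((s / 2 : ℝ) : ℂ) • diagOp e lam)) from rfl, norm_star]
    exact norm_cayInv_le (isSelfAdjoint_ofReal_smul isSelfAdjoint_diagOp _)
  have hpu : ∀ t : ℝ, (p.u t : 𝓗 →L[ℂ] 𝓗)
    = u * ((2 : ℂ) • cayInv (((t / 2 : ℝ) : ℂ) • diagOp e lam) - 1) := fun _ => rfl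
  have h0 : (p.u 0 : 𝓗 →L[ℂ] 𝓗) = u := by
    rw [hpu, zero_div, Complex.ofReal_zero, zero_smul, cayInv, smul_zero, sub_zero,
      Ring.inverse_one, two_smul]
    simp
  have h1 : (p.u 1 : 𝓗 →L[ℂ] 𝓗) = (u * cayley ha : unitary (𝓗 →L[ℂ] 𝓗)) := by
    rw [hpu, Submonoid.coe_mul, coe_cayley]
    norm_num
  refine ⟨p.shift 0 1, ?_, fun g => ?_⟩
  · have := p.hasShift he hl 0 1
    rwa [h0, h1] at this
  · have := p.norm_shift_le he hl (α := 0) (β := 1) (fun s _ => hA s) g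
    simpa using this

lemma diagOp_eq_update_add [DecidableEq ι] (he : Orthonormal ℂ e) (hl : Summable lam) (a : ι) :
    diagOp e lam = diagOp e (Function.update lam a 0) + (lam a : ℂ) • lineProj (e a) := by
  have h1 := (summable_diagOp he hl).hasSum
  have h2 := h1.update a 0
  have h3 : (fun j => ((Function.update lam a 0 j : ℝ) : ℂ) •
      InnerProductSpace.rankOne ℂ (e j) (e j))
      = Function.update (fun j => (lam j : ℂ) • InnerProductSpace.rankOne ℂ (e j) (e j)) a 0 := by
    ext1 j
    by_cases h : j = a
    · subst h; simp
    · simp [h]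
  rw [← h3] at h2
  have h4 : diagOp e (Function.update lam a 0) = _ := h2.tsum_eq
  rw [h4, zero_sub, neg_add_eq_sub, sub_add_cancel]
  rfl

/-- Splitting off a line from a Cayley transform. -/
lemma cayInv_add_smul_lineProj {x : 𝓗} (hx : ‖x‖ = 1) {a : 𝓗 →L[ℂ] 𝓗} (ha : IsSelfAdjoint a)
    (hax : a x = 0) (k : ℝ) (hb : IsSelfAdjoint (a + (k : ℂ) • lineProj x)) :
    cayInv (a + (k : ℂ) • lineProj x)
      = cayInv a + ((1 - I * k)⁻¹ - 1) • lineProj x := by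
  have h1 : a * lineProj x = 0 := by
    ext y
    simp [InnerProductSpace.rankOne_apply, hax]
  have h2 : lineProj x * a = 0 := by
    rw [← star_inj, star_mul, star_lineProj, ha.star_eq, h1, star_zero]
  have h3 : lineProj x * cayInv a = lineProj x := by
    calc _ = lineProj x * ((1 - I • a) * cayInv a) := by
          rw [← mul_assoc, mul_sub, mul_one, mul_smul_comm, h2, smul_zero, sub_zero]
      _ = _ := by rw [mul_cayInv ha, mul_one]
  have hk : (1 - I * k : ℂ) ≠ 0 := fun h => by
    have := congrArg Complex.re h
    simp at this
  symm
  refine eq_cayInv hb ?_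
  have h4 : (1 - I • (a + (k : ℂ) • lineProj x)) = (1 - I • a) - (I * k) • lineProj x := by
    module
  rw [h4, sub_mul, mul_add, mul_add, mul_cayInv ha, mul_smul_comm, sub_mul, one_mul,
    smul_mul_assoc, smul_mul_assoc, smul_mul_assoc, h1, h3, mul_smul_comm, lineProj_mul_self hx,
    smul_zero, sub_zero]
  have h5 : ((1 - I * k)⁻¹ - 1 - I * k - (I * k) * ((1 - I * k)⁻¹ - 1) : ℂ) = 0 := by
    field_simp
    ring
  have h6 : (1 : 𝓗 →L[ℂ] 𝓗) + ((1 - I * k)⁻¹ - 1) • lineProj x - ((I * k) • lineProj x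
      + (I * k) • ((1 - I * k)⁻¹ - 1) • lineProj x)
      = 1 + ((1 - I * k)⁻¹ - 1 - I * k - (I * k) * ((1 - I * k)⁻¹ - 1)) • lineProj x := by
    module
  rw [h6, h5, zero_smul, add_zero]

lemma norm_two_mul_inv_sub_one (k : ℝ) : ‖(2 * (1 - I * k)⁻¹ - 1 : ℂ)‖ = 1 := by
  have hk : (1 - I * k : ℂ) ≠ 0 := fun h => by
    have := congrArg Complex.re h
    simp at this
  have h : (2 * (1 - I * k)⁻¹ - 1 : ℂ) = (starRingEnd ℂ) (1 - I * k) / (1 - I * k) := by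
    have : (starRingEnd ℂ) (1 - I * k) = 1 + I * k := by simp
    rw [this]
    field_simp
    ring
  rw [h, norm_div, RCLike.norm_conj, div_self (norm_ne_zero_iff.2 hk)]

lemma cayley_add_smul_lineProj {x : 𝓗} (hx : ‖x‖ = 1) {a : 𝓗 →L[ℂ] 𝓗} (ha : IsSelfAdjoint a)
    (hax : a x = 0) (k : ℝ) (hb : IsSelfAdjoint (a + (k : ℂ) • lineProj x)) :
    cayley hb = lineRot hx (norm_two_mul_inv_sub_one k) * cayley ha := by
  apply Subtype.ext
  have h1 : lineProj x * cayInv a = lineProj x := by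
    have h2 : lineProj x * a = 0 := by
      have h1 : a * lineProj x = 0 := by
        ext y
        simp [InnerProductSpace.rankOne_apply, hax]
      rw [← star_inj, star_mul, star_lineProj, ha.star_eq, h1, star_zero]
    calc _ = lineProj x * ((1 - I • a) * cayInv a) := by
          rw [← mul_assoc, mul_sub, mul_one, mul_smul_comm, h2, smul_zero, sub_zero]
      _ = _ := by rw [mul_cayInv ha, mul_one]
  rw [Submonoid.coe_mul, coe_lineRot, coe_cayley, coe_cayley,
    cayInv_add_smul_lineProj hx ha hax k hb, add_mul, one_mul, smul_mul_assoc, mul_sub,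
    mul_smul_comm, h1, mul_one]
  module

lemma exists_shiftBound_cayley_finset (F : Finset ι) (he : Orthonormal ℂ e) :
    ∀ (lam : ι → ℝ) (_ : Summable lam) (u : unitary (𝓗 →L[ℂ] 𝓗))
      (ha : IsSelfAdjoint ((1 / 2 : ℂ) • diagOp e lam)),
      ∃ C, 0 ≤ C ∧ ShiftBound C (∑' j, (F : Set ι)ᶜ.indicator (fun j => |lam j|) j)
        (u : 𝓗 →L[ℂ] 𝓗) ((u * cayley ha : unitary (𝓗 →L[ℂ] 𝓗))) := by
  classical
  induction F using Finset.induction_on with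
  | empty =>
    intro lam hl u ha
    refine ⟨0, le_rfl, ?_⟩
    simpa using shiftBound_cayley u he hl ha
  | insert a F haF ih =>
    intro lam hl u ha
    have hl' : Summable (Function.update lam a 0) := (hl.hasSum.update a 0).summable
    have hb : IsSelfAdjoint ((1 / 2 : ℂ) • diagOp e (Function.update lam a 0)) := by
      have := isSelfAdjoint_ofReal_smul
        (isSelfAdjoint_diagOp (e := e) (lam := Function.update lam a 0)) (1 / 2)
      simpa using this
    have hsplit : (1 / 2 : ℂ) • diagOp e lam = (1 / 2 : ℂ) • diagOp e (Function.update lam a 0)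
        + ((lam a / 2 : ℝ) : ℂ) • lineProj (e a) := by
      rw [diagOp_eq_update_add he hl a, smul_add, smul_smul]
      congr 2
      push_cast
      ring
    have hc := ha
    rw [hsplit] at hc
    have hx : ((1 / 2 : ℂ) • diagOp e (Function.update lam a 0)) (e a) = 0 := by
      rw [smul_apply, diagOp_apply_self he hl']
      simp
    have hcay := cayley_add_smul_lineProj (he.1 a) hb hx (lam a / 2) hc
    have hcay' : cayley ha = cayley hc := by
      apply Subtype.ext
      rw [coe_cayley, coe_cayley, hsplit]
    rw [hcay', hcay, ← mul_assoc]
    obtain ⟨C, hC, h1⟩ := exists_shiftBound_lineRot u (he.1 a)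
      (norm_two_mul_inv_sub_one (lam a / 2))
    obtain ⟨C', hC', h2⟩ := ih _ hl'
      (u * lineRot (he.1 a) (norm_two_mul_inv_sub_one (lam a / 2))) hb
    refine ⟨C + C', add_nonneg hC hC', ?_⟩
    have h3 := h1.trans h2
    rw [zero_add] at h3
    convert h3 using 3 with j
    by_cases hja : j = a
    · subst hja; simp [Set.indicator]
    · simp [Set.indicator, hja]

lemma exists_shiftBound_cayley (he : Orthonormal ℂ e) (hl : Summable lam)
    (u : unitary (𝓗 →L[ℂ] 𝓗)) (ha : IsSelfAdjoint ((1 / 2 : ℂ) • diagOp e lam)) {ε : ℝ}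
    (hε : 0 < ε) :
    ∃ C, 0 ≤ C ∧ ShiftBound C ε (u : 𝓗 →L[ℂ] 𝓗) ((u * cayley ha : unitary (𝓗 →L[ℂ] 𝓗))) := by
  have ht := tendsto_tsum_compl_atTop_zero fun j => |lam j|
  obtain ⟨F, hF⟩ := (ht.eventually (gt_mem_nhds hε)).exists
  obtain ⟨C, hC, L, hL, hb⟩ := exists_shiftBound_cayley_finset F he lam hl u ha
  refine ⟨C, hC, L, hL, fun g => (hb g).trans ?_⟩
  have : ∑' j, (F : Set ι)ᶜ.indicator (fun j => |lam j|) j < ε := by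
    rw [← tsum_subtype]
    exact hF
  gcongr

end cayleyPath

lemma exists_eq_cayley {w : unitary (𝓗 →L[ℂ] 𝓗)} (hw : ‖(w : 𝓗 →L[ℂ] 𝓗) - 1‖ < 1)
    (ht : IsTraceClass ((w : 𝓗 →L[ℂ] 𝓗) - 1)) :
    ∃ (a : 𝓗 →L[ℂ] 𝓗) (ha : IsSelfAdjoint a), IsTraceClass a ∧ w = cayley ha := by
  set W : 𝓗 →L[ℂ] 𝓗 := (w : 𝓗 →L[ℂ] 𝓗) with hW
  have hu : IsUnit (1 + W) := by
    have h1 : ‖(1 / 2 : ℂ) • (1 - W)‖ < 1 := by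
      rw [norm_smul, norm_sub_rev]
      norm_num
      linarith
    have h2 := (isUnit_one_sub_of_norm_lt_one h1).smul (Units.mk0 (2 : ℂ) two_ne_zero)
    have h3 : Units.mk0 (2 : ℂ) two_ne_zero • (1 - (1 / 2 : ℂ) • (1 - W)) = 1 + W := by
      rw [Units.smul_mk0]
      module
    rwa [h3] at h2
  set Q := Ring.inverse (1 + W) with hQ
  have hQ1 : Q * (1 + W) = 1 := Ring.inverse_mul_cancel _ hu
  have hQ2 : (1 + W) * Q = 1 := Ring.mul_inverse_cancel _ hu
  have hWW : star W * W = 1 := Unitary.coe_star_mul_self w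
  have hsQ : star Q * (1 + star W) = 1 := by
    have := congrArg star hQ2
    simpa [star_mul, star_add] using this
  have hkey : star Q * (1 - star W) = (W - 1) * Q := by
    have h1 : star Q * (1 - star W) * (1 + W) = W - 1 := by
      have : (1 - star W) * (1 + W) = (1 + star W) * (W - 1) := by
        simp only [sub_mul, mul_add, add_mul, mul_sub, one_mul, mul_one, hWW]
        abel
      rw [mul_assoc, this, ← mul_assoc, hsQ, one_mul]
    rw [← h1, mul_assoc _ (1 + W) Q, hQ2, mul_one]
  have ha : IsSelfAdjoint (I • ((1 - W) * Q)) := by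
    rw [IsSelfAdjoint, star_smul, star_mul, star_sub, star_one, hkey, ← starRingEnd_apply,
      Complex.conj_I, neg_smul, ← smul_neg, ← neg_mul, neg_sub]
  refine ⟨_, ha, ?_, ?_⟩
  · rw [show (1 - W) = (-1 : ℂ) • (W - 1) by module, smul_mul_assoc]
    exact ((ht.mul_right Q).smul _).smul _
  · apply Subtype.ext
    have h1 : (1 / 2 : ℂ) • (1 + W) = cayInv (I • ((1 - W) * Q)) := by
      refine eq_cayInv ha ?_
      rw [smul_smul, Complex.I_mul_I, neg_one_smul, sub_neg_eq_add, mul_smul_comm, add_mul,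
        one_mul, mul_assoc, hQ1, mul_one]
      module
    rw [coe_cayley, ← h1]
    module

/-- Close unitaries with trace class difference have shift functionals which are dominated by
`C ∫ |g| + ε ‖g‖` with arbitrarily small `ε`. -/
lemma exists_shiftBound_of_norm_sub_lt {u u' : unitary (𝓗 →L[ℂ] 𝓗)}
    (h : ‖(u' : 𝓗 →L[ℂ] 𝓗) - u‖ < 1)
    (ht : IsTraceClass ((u' : 𝓗 →L[ℂ] 𝓗) - (u : 𝓗 →L[ℂ] 𝓗))) {ε : ℝ} (hε : 0 < ε) :
    ∃ C, 0 ≤ C ∧ ShiftBound C ε (u : 𝓗 →L[ℂ] 𝓗) u' := by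
  have hw : ((star u * u' : unitary (𝓗 →L[ℂ] 𝓗)) : 𝓗 →L[ℂ] 𝓗) - 1
      = ((star u : unitary (𝓗 →L[ℂ] 𝓗)) : 𝓗 →L[ℂ] 𝓗) * ((u' : 𝓗 →L[ℂ] 𝓗) - (u : 𝓗 →L[ℂ] 𝓗)) := by
    rw [mul_sub, Submonoid.coe_mul, Unitary.coe_star, Unitary.coe_star_mul_self]
  obtain ⟨a, ha, hta, hwa⟩ := exists_eq_cayley (w := star u * u')
    (by rw [hw, CStarRing.norm_coe_unitary_mul]; exact h) (by rw [hw]; exact ht.mul_left _)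
  have h2a : IsSelfAdjoint ((2 : ℂ) • a) := by
    have := isSelfAdjoint_ofReal_smul ha 2
    simpa using this
  obtain ⟨w, e, lam, he, hl, hd⟩ := (hta.smul 2).exists_eq_diagOp h2a
  have hhalf : (1 / 2 : ℂ) • diagOp e lam = a := by
    rw [← hd, smul_smul]
    norm_num
  have ha' : IsSelfAdjoint ((1 / 2 : ℂ) • diagOp e lam) := by rwa [hhalf]
  have hu' : u' = u * cayley ha' := by
    have : cayley ha' = cayley ha := by
      apply Subtype.ext
      rw [coe_cayley, coe_cayley, hhalf]
    rw [this, ← hwa, ← mul_assoc, Unitary.mul_star_self, one_mul]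
  rw [hu']
  exact exists_shiftBound_cayley he hl u ha' hε

namespace UnitaryPath

variable {ι : Type*} {e : ι → 𝓗} {lam : ι → ℝ} (p : UnitaryPath e lam)

lemma exists_shiftBound (hD : IsTraceClass (diagOp e lam)) (α β : ℝ) {ε : ℝ} (hε : 0 < ε) :
    ∃ C, 0 ≤ C ∧ ShiftBound C ε (p.u α : 𝓗 →L[ℂ] 𝓗) (p.u β) := by
  have htc : ∀ s t, IsTraceClass ((p.u t : 𝓗 →L[ℂ] 𝓗) - (p.u s : 𝓗 →L[ℂ] 𝓗)) := fun s t => by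
    rw [p.sub_eq s t]
    exact ((hD.mul_left _).mul_right _).smul _
  let P : ℝ → ℝ → Prop := fun s t => ∀ ε : ℝ, 0 < ε →
    ∃ C, 0 ≤ C ∧ ShiftBound C ε (p.u s : 𝓗 →L[ℂ] 𝓗) (p.u t)
  have htrans : IsTrans ℝ P := ⟨fun r s t h h' ε hε => by
    obtain ⟨C, hC, hb⟩ := h (ε / 2) (half_pos hε)
    obtain ⟨C', hC', hb'⟩ := h' (ε / 2) (half_pos hε)
    refine ⟨C + C', add_nonneg hC hC', ?_⟩
    have := hb.trans hb'
    rwa [add_halves] at this⟩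
  refine PreconnectedSpace.induction₂' P (fun s => ?_) htrans α β ε hε
  have hcont : Continuous fun t => ‖(p.u t : 𝓗 →L[ℂ] 𝓗) - (p.u s : 𝓗 →L[ℂ] 𝓗)‖ :=
    ((continuous_subtype_val.comp p.continuous_u).sub continuous_const).norm
  have h1 : ∀ᶠ t in 𝓝 s, ‖(p.u t : 𝓗 →L[ℂ] 𝓗) - (p.u s : 𝓗 →L[ℂ] 𝓗)‖ < 1 :=
    hcont.continuousAt.eventually (gt_mem_nhds (by simp))
  filter_upwards [h1] with t ht
  exact ⟨fun ε hε => exists_shiftBound_of_norm_sub_lt ht (htc s t) hε,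
    fun ε hε => exists_shiftBound_of_norm_sub_lt (by rwa [norm_sub_rev]) (htc t s) hε⟩

lemma exists_norm_shift_le_integral (he : Orthonormal ℂ e) (hl : Summable lam)
    (hD : IsTraceClass (diagOp e lam)) (α β : ℝ) {ε : ℝ} (hε : 0 < ε) :
    ∃ C, ∀ g, ‖p.shift α β g‖
      ≤ C * (∫ x, ‖g x‖ ∂AddCircle.haarAddCircle) + ε * ‖g‖ := by
  obtain ⟨C, hC, hb⟩ := p.exists_shiftBound hD α β hε
  obtain ⟨M, hM⟩ := isCompact_uIcc.exists_bound_of_continuousOn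
    (p.continuous_A.continuousOn (s := uIcc α β))
  exact hb.norm_le hC (p.hasShift he hl α β)
    (p.norm_shift_le he hl fun s hs => hM s (uIoc_subset_uIcc hs))

end UnitaryPath

/-- The resolvents at `z` of a line `H + t V` of self-adjoint operators. -/
structure ResolventPath (z : ℂ) (V : 𝓗 →L[ℂ] 𝓗) where
  R : ℝ → 𝓗 →L[ℂ] 𝓗
  sub_eq : ∀ s t, R t - R s = -((t - s : ℂ) • (R t * V * R s))
  sub_star : ∀ s, R s - star (R s) = (z - (starRingEnd ℂ) z) • (R s * star (R s))
  star_mul_comm : ∀ s, star (R s) * R s = R s * star (R s)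
  exists_norm_le : ∃ M, ∀ s, ‖R s‖ ≤ M
  isSelfAdjoint : IsSelfAdjoint V

namespace ResolventPath

variable {z : ℂ} {V : 𝓗 →L[ℂ] 𝓗} (r : ResolventPath z V)

lemma continuous_R : Continuous r.R := by
  obtain ⟨M, hM⟩ := r.exists_norm_le
  have hM0 : 0 ≤ M := (norm_nonneg _).trans (hM 0)
  refine LipschitzWith.continuous (K := ⟨M * ‖V‖ * M, by positivity⟩)
    (LipschitzWith.of_dist_le_mul fun t s => ?_)
  rw [dist_eq_norm, r.sub_eq s t, norm_neg, norm_smul, dist_eq_norm, mul_comm]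
  have h1 : ‖(t - s : ℂ)‖ = ‖t - s‖ := by rw [← Complex.ofReal_sub, Complex.norm_real]
  rw [h1]
  gcongr
  calc _ ≤ ‖r.R t‖ * ‖V‖ * ‖r.R s‖ :=
        (norm_mul_le _ _).trans (mul_le_mul_of_nonneg_right (norm_mul_le _ _) (norm_nonneg _))
    _ ≤ M * ‖V‖ * M := by gcongr <;> exact hM _

/-- The Cayley transform `(H - z̄) (H - z)⁻¹`. -/
def unit (s : ℝ) : unitary (𝓗 →L[ℂ] 𝓗) :=
  ⟨1 + (z - (starRingEnd ℂ) z) • r.R s, by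
    have h := r.sub_star s
    have hs : star (1 + (z - (starRingEnd ℂ) z) • r.R s)
        = 1 - (z - (starRingEnd ℂ) z) • star (r.R s) := by
      rw [star_add, star_one, star_smul, ← starRingEnd_apply, map_sub, Complex.conj_conj]
      module
    rw [Unitary.mem_iff, hs]
    set c := z - (starRingEnd ℂ) z
    have h2 : (c * c) • (r.R s * star (r.R s)) = c • r.R s - c • star (r.R s) := by
      rw [mul_smul, ← h, smul_sub]
    constructor
    · simp only [sub_mul, mul_add, one_mul, mul_one, smul_mul_smul_comm, r.star_mul_comm s]
      rw [h2]
      abel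
    · simp only [mul_sub, add_mul, one_mul, mul_one, smul_mul_smul_comm]
      rw [h2]
      abel⟩

lemma coe_unit (s : ℝ) : (r.unit s : 𝓗 →L[ℂ] 𝓗) = 1 + (z - (starRingEnd ℂ) z) • r.R s := rfl

lemma unit_mul_star_R (s : ℝ) : (r.unit s : 𝓗 →L[ℂ] 𝓗) * star (r.R s) = r.R s := by
  rw [coe_unit, add_mul, one_mul, smul_mul_assoc, ← r.sub_star]
  abel

/-- The operator `1 - s R̄_s V`. -/
def A (s : ℝ) : 𝓗 →L[ℂ] 𝓗 := 1 - (s : ℂ) • (star (r.R s) * V)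

lemma star_A (s : ℝ) : star (r.A s) = 1 - (s : ℂ) • (V * r.R s) := by
  rw [A, star_sub, star_one, star_smul, star_mul, star_star, r.isSelfAdjoint.star_eq,
    ← starRingEnd_apply, Complex.conj_ofReal]

lemma R_zero_mul_star_A (s : ℝ) : r.R 0 * star (r.A s) = r.R s := by
  have h := r.sub_eq s 0
  rw [star_A, mul_sub, mul_one, mul_smul_comm, ← mul_assoc]
  rw [Complex.ofReal_zero, zero_sub, neg_smul, neg_neg] at h
  rw [← h]
  abel

lemma unit_mul_A (s : ℝ) : (r.unit s : 𝓗 →L[ℂ] 𝓗) * r.A s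
    = (1 - (s : ℂ) • (r.R s * V)) * r.unit 0 := by
  have h := r.sub_eq 0 s
  rw [Complex.ofReal_zero, sub_zero] at h
  have h' : r.R s = r.R 0 - (s : ℂ) • (r.R s * V * r.R 0) := by
    rw [sub_eq_add_neg, ← h]; abel
  rw [A, mul_sub, mul_one, mul_smul_comm, ← mul_assoc, unit_mul_star_R, coe_unit, coe_unit, mul_add,
    mul_one, mul_smul_comm, sub_mul, one_mul, smul_mul_assoc]
  nth_rewrite 1 [h']
  abel

lemma one_sub_mul_R_zero (s : ℝ) : (1 - (s : ℂ) • (r.R s * V)) * r.R 0 = r.R s := by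
  have h := r.sub_eq 0 s
  rw [Complex.ofReal_zero, sub_zero] at h
  rw [sub_mul, one_mul, smul_mul_assoc, sub_eq_add_neg, ← h]
  abel

lemma continuous_A : Continuous r.A := by
  have h := r.continuous_R
  unfold A
  fun_prop

/-- The self-adjoint operator `i (z - z̄) R̄₀ V R₀`. -/
def D : 𝓗 →L[ℂ] 𝓗 := (((-2 * z.im : ℝ)) : ℂ) • (star (r.R 0) * V * r.R 0)

lemma isSelfAdjoint_D : IsSelfAdjoint r.D := by
  refine isSelfAdjoint_ofReal_smul ?_ _
  rw [IsSelfAdjoint, star_mul, star_mul, star_star, r.isSelfAdjoint.star_eq, mul_assoc]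

lemma isTraceClass_D (h : IsTraceClass (r.R 1 - r.R 0)) : IsTraceClass r.D := by
  have h3 : r.R 0 * V * r.R 0 = -((1 + r.R 0 * V) * (r.R 1 - r.R 0)) := by
    have h2 : (1 + r.R 0 * V) * r.R 1 = r.R 0 := by
      have := r.sub_eq 1 0
      simp only [Complex.ofReal_zero, Complex.ofReal_one, zero_sub, neg_smul, one_smul,
        neg_neg] at this
      rw [add_mul, one_mul, ← this]
      abel
    rw [mul_sub, h2, add_mul, one_mul]
    abel
  have h4 : star (r.R 0) * V * r.R 0 = star (r.unit 0 : 𝓗 →L[ℂ] 𝓗) * (r.R 0 * V * r.R 0) := by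
    have : star (r.unit 0 : 𝓗 →L[ℂ] 𝓗) * r.R 0 = star (r.R 0) := by
      calc _ = star (r.unit 0 : 𝓗 →L[ℂ] 𝓗) * ((r.unit 0 : 𝓗 →L[ℂ] 𝓗) * star (r.R 0)) := by
            rw [r.unit_mul_star_R]
        _ = _ := by rw [← mul_assoc, Unitary.coe_star_mul_self, one_mul]
    rw [← mul_assoc, ← mul_assoc, this]
  rw [D, h4, h3, ← neg_mul]
  exact ((h.mul_left _).mul_left _).smul _

variable {ι : Type*} {e : ι → 𝓗} {lam : ι → ℝ}

/-- The path of Cayley transforms of a line of self-adjoint operators. -/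
def toUnitaryPath (hD : r.D = diagOp e lam) : UnitaryPath e lam where
  u := r.unit
  A := r.A
  G t := I • ((r.unit t : 𝓗 →L[ℂ] 𝓗) * r.A t)
  q t := t
  q' _ := 1
  continuous_u := by
    have h := r.continuous_R
    refine Continuous.subtype_mk (f := fun s : ℝ => 1 + (z - (starRingEnd ℂ) z) • r.R s) ?_ _
    fun_prop
  continuous_A := r.continuous_A
  continuous_G := by
    have h := r.continuous_R
    have h' := r.continuous_A
    change Continuous fun t : ℝ => I • ((1 + (z - (starRingEnd ℂ) z) • r.R t) * r.A t)
    fun_prop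
  hasDerivAt_q t := Complex.ofRealCLM.hasDerivAt
  deriv_eq s := by rw [one_smul]
  sub_eq s t := by
    have hz : I * (((-2 * z.im : ℝ)) : ℂ) = -(z - (starRingEnd ℂ) z) := by
      rw [Complex.sub_conj]
      push_cast
      ring
    have h1 : (r.unit 0 : 𝓗 →L[ℂ] 𝓗) * (star (r.R 0) * V * r.R 0) = r.R 0 * V * r.R 0 := by
      rw [← mul_assoc, ← mul_assoc, r.unit_mul_star_R]
    have h2 : r.R t * V * r.R s = (r.unit t : 𝓗 →L[ℂ] 𝓗) * r.A t *
        (star (r.R 0) * V * r.R 0) * star (r.A s) := by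
      calc _ = (1 - (t : ℂ) • (r.R t * V)) * r.R 0 * V * (r.R 0 * star (r.A s)) := by
            rw [r.one_sub_mul_R_zero, r.R_zero_mul_star_A]
        _ = _ := by
            rw [r.unit_mul_A, mul_assoc _ _ (star (r.R 0) * V * r.R 0), h1]
            simp only [mul_assoc]
    rw [← hD, D, coe_unit, coe_unit, add_sub_add_left_eq_sub, ← smul_sub, r.sub_eq s t, h2]
    simp only [smul_mul_assoc, mul_smul_comm, smul_smul, ← neg_smul]
    congr 1
    linear_combination (s - t : ℂ) * hz

end ResolventPath

namespace SpectralMeasure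

variable {H : SelfAdjointOperator 𝓗}

lemma star_resolvent (E : SpectralMeasure H) {z : ℂ} (hz : z.im ≠ 0) :
    star (H.resolvent z) = H.resolvent ((starRingEnd ℂ) z) := by
  rw [E.resolvent_eq_fc hz, E.resolvent_eq_fc (by simpa using hz),
    ContinuousLinearMap.star_eq_adjoint,
    E.adjoint_fc_cauchy hz]

lemma fc_const_mul (E : SpectralMeasure H) {φ : ℝ → ℂ} (c : ℂ) (hφ : BddMeas φ) :
    E.fc (fun x => c * φ x) = c • E.fc φ := by
  rw [E.fc_mul (BddMeas.const c) hφ, E.fc_const, smul_mul_assoc, one_mul]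

lemma resolvent_sub_star (E : SpectralMeasure H) {z : ℂ} (hz : z.im ≠ 0) :
    H.resolvent z - star (H.resolvent z)
      = (z - (starRingEnd ℂ) z) • (H.resolvent z * star (H.resolvent z)) := by
  have hz' : ((starRingEnd ℂ) z).im ≠ 0 := by simpa using hz
  have h1 := bddMeas_cauchy hz
  have h2 := bddMeas_cauchy hz'
  rw [E.star_resolvent hz, E.resolvent_eq_fc hz, E.resolvent_eq_fc hz', ← E.fc_mul h1 h2,
    ← E.fc_const_mul _ (h1.mul h2), sub_eq_iff_eq_add', ← E.fc_add h2 ((BddMeas.const _).mul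
      (h1.mul h2))]
  congr 1
  funext x
  have h3 := ofReal_sub_ne_zero hz x
  have h4 := ofReal_sub_ne_zero hz' x
  simp only [cauchy]
  field_simp
  ring

lemma star_mul_resolvent_comm (E : SpectralMeasure H) {z : ℂ} (hz : z.im ≠ 0) :
    star (H.resolvent z) * H.resolvent z = H.resolvent z * star (H.resolvent z) := by
  have hz' : ((starRingEnd ℂ) z).im ≠ 0 := by simpa using hz
  have h1 := bddMeas_cauchy hz
  have h2 := bddMeas_cauchy hz'
  rw [E.star_resolvent hz, E.resolvent_eq_fc hz, E.resolvent_eq_fc hz', ← E.fc_mul h1 h2,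
    ← E.fc_mul h2 h1]
  simp only [mul_comm]

lemma norm_resolvent_le (E : SpectralMeasure H) {z : ℂ} (hz : z.im ≠ 0) :
    ‖H.resolvent z‖ ≤ |z.im|⁻¹ := by
  rw [E.resolvent_eq_fc hz]
  exact E.norm_fc_le (bddMeas_cauchy hz) (norm_cauchy_le hz)

end SpectralMeasure

lemma IsSum.resolvent_sub {H₀ H₁ : SelfAdjointOperator 𝓗} {V : 𝓗 →L[ℂ] 𝓗} (h : IsSum H₀ V H₁)
    (E₀ : SpectralMeasure H₀) (E₁ : SpectralMeasure H₁) (hV : IsSelfAdjoint V) {z : ℂ}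
    (hz : z.im ≠ 0) :
    H₁.resolvent z - H₀.resolvent z = -(H₀.resolvent z * V * H₁.resolvent z) := by
  have hz' : ((starRingEnd ℂ) z).im ≠ 0 := by simpa using hz
  have := congrArg star (h _ hz')
  change star _ = star (-(_ * (V * _))) at this
  rwa [star_sub, star_neg, star_mul, star_mul, hV.star_eq, E₀.star_resolvent hz',
    E₁.star_resolvent hz', Complex.conj_conj] at this

namespace AffineSetting

variable (𝒜 : AffineSetting 𝓗)

lemma resolvent_sub_resolvent (E : ∀ V : 𝓗 →L[ℂ] 𝓗, SpectralMeasure (𝒜.opOf V))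
    {U W : 𝓗 →L[ℂ] 𝓗} (hU : U ∈ 𝒜.A0) (hW : W ∈ 𝒜.A0) {z : ℂ}
    (hz : z.im ≠ 0) : (𝒜.opOf W).resolvent z - (𝒜.opOf U).resolvent z
      = -((𝒜.opOf W).resolvent z * (W - U) * (𝒜.opOf U).resolvent z) := by
  have hA : (𝒜.opOf W).resolvent z - (𝒜.opOf 0).resolvent z
      = -((𝒜.opOf W).resolvent z * (W * (𝒜.opOf 0).resolvent z)) := 𝒜.opOf_spec W hW z hz
  have hB := (𝒜.opOf_spec U hU).resolvent_sub (E 0) (E U) (𝒜.sa_mem U hU) hz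
  set A := (𝒜.opOf W).resolvent z
  set B := (𝒜.opOf U).resolvent z
  set O := (𝒜.opOf 0).resolvent z
  have h1 : A * W * O = O - A := by rw [← neg_sub A O, hA, neg_neg, mul_assoc]
  have h2 : O - O * U * B = B := by rw [sub_eq_add_neg, ← hB]; abel
  have h3 : A * W * B = O - A - (O - A) * (U * B) := by
    calc _ = A * W * (O - O * U * B) := by rw [h2]
      _ = A * W * O - A * W * O * (U * B) := by simp only [mul_sub, mul_assoc]
      _ = _ := by rw [h1]
  rw [mul_sub, sub_mul, h3, sub_mul, ← mul_assoc, ← mul_assoc]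
  nth_rewrite 1 [← h2]
  abel

/-- The resolvents at `z` along the segment from `W₀` to `W₁`. -/
def resolventPath (E : ∀ V : 𝓗 →L[ℂ] 𝓗, SpectralMeasure (𝒜.opOf V))
    {W₀ W₁ : 𝓗 →L[ℂ] 𝓗} (h₀ : W₀ ∈ 𝒜.A0) (h₁ : W₁ ∈ 𝒜.A0) {z : ℂ}
    (hz : z.im ≠ 0) : ResolventPath z (W₁ - W₀) where
  R s := (𝒜.opOf (W₀ + (s : ℂ) • (W₁ - W₀))).resolvent z
  sub_eq s t := by
    have hV : W₁ - W₀ ∈ 𝒜.A0 := by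
      rw [sub_eq_add_neg]
      exact 𝒜.add_mem h₁ (𝒜.neg_mem h₀)
    rw [𝒜.resolvent_sub_resolvent E (𝒜.add_mem h₀ (𝒜.smul_mem s hV))
      (𝒜.add_mem h₀ (𝒜.smul_mem t hV)) hz, add_sub_add_left_eq_sub, ← sub_smul, mul_smul_comm,
      smul_mul_assoc]
  sub_star s := (E _).resolvent_sub_star hz
  star_mul_comm s := (E _).star_mul_resolvent_comm hz
  exists_norm_le := ⟨_, fun s => (E _).norm_resolvent_le hz⟩
  isSelfAdjoint := (𝒜.sa_mem _ h₁).sub (𝒜.sa_mem _ h₀)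

end AffineSetting

/-- The angle of `(x - z̄) / (x - z)`, in turns. -/
def cayleyAngle (z : ℂ) (x : ℝ) : ℝ := 1 / 2 - Real.arctan ((x - z.re) / z.im) / π

section cayleyAngle

variable {z : ℂ}

lemma cayleyAngle_mem_Ioo (z : ℂ) (x : ℝ) : cayleyAngle z x ∈ Ioo (0 : ℝ) 1 := by
  have h1 := Real.neg_pi_div_two_lt_arctan ((x - z.re) / z.im)
  have h2 := Real.arctan_lt_pi_div_two ((x - z.re) / z.im)
  have hpi := Real.pi_pos
  have h3 : Real.arctan ((x - z.re) / z.im) / π < 1 / 2 := by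
    rw [div_lt_iff₀ hpi]; linarith
  have h4 : -(1 / 2) < Real.arctan ((x - z.re) / z.im) / π := by
    rw [lt_div_iff₀ hpi]; linarith
  constructor <;> rw [cayleyAngle] <;> linarith

lemma image_cayleyAngle (hz : z.im ≠ 0) : cayleyAngle z '' univ = Ioo (0 : ℝ) 1 := by
  refine Subset.antisymm (by rintro _ ⟨x, -, rfl⟩; exact cayleyAngle_mem_Ioo z x) fun t ht => ?_
  have hpi := Real.pi_pos
  have h : (1 / 2 - t) * π ∈ range Real.arctan := by
    rw [Real.range_arctan]
    constructor <;> nlinarith [ht.1, ht.2]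
  obtain ⟨y, hy⟩ := h
  refine ⟨z.re + z.im * y, mem_univ _, ?_⟩
  rw [cayleyAngle, add_sub_cancel_left, mul_div_cancel_left₀ _ hz, hy,
    mul_div_cancel_right₀ _ hpi.ne']
  ring

lemma cayleyAngle_injective (hz : z.im ≠ 0) : Function.Injective (cayleyAngle z) := by
  intro x y h
  have hpi := Real.pi_ne_zero
  rw [cayleyAngle, cayleyAngle, sub_right_inj, div_left_inj' hpi] at h
  have := Real.arctan_injective h
  rwa [div_left_inj' hz, sub_left_inj] at this

lemma normSq_ofReal_sub (z : ℂ) (x : ℝ) :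
    Complex.normSq (x - z) = (x - z.re) ^ 2 + z.im ^ 2 := by
  rw [Complex.normSq_apply]
  simp
  ring

lemma hasDerivAt_cayleyAngle (hz : z.im ≠ 0) (x : ℝ) :
    HasDerivAt (cayleyAngle z) (-(z.im / π) / Complex.normSq (x - z)) x := by
  have h1 : HasDerivAt (fun x : ℝ => (x - z.re) / z.im) (1 / z.im) x :=
    ((hasDerivAt_id x).sub_const _).div_const _
  have h2 := ((h1.arctan).div_const π).const_sub (1 / 2)
  have hpi := Real.pi_ne_zero
  have h4 : (x - z.re) ^ 2 + z.im ^ 2 ≠ 0 := by positivity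
  have h5 : 1 + ((x - z.re) / z.im) ^ 2 ≠ 0 := by positivity
  refine h2.congr_deriv ?_
  rw [normSq_ofReal_sub]
  have h6 : 1 + ((x - z.re) / z.im) ^ 2 = ((x - z.re) ^ 2 + z.im ^ 2) / z.im ^ 2 := by
    field_simp
    ring
  rw [h6]
  field_simp

lemma continuous_cayleyAngle (hz : z.im ≠ 0) : Continuous (cayleyAngle z) :=
  continuous_iff_continuousAt.2 fun x => (hasDerivAt_cayleyAngle hz x).continuousAt

lemma isOpenMap_cayleyAngle (hz : z.im ≠ 0) : IsOpenMap (cayleyAngle z) := by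
  have h1 : IsOpenMap Real.arctan := by
    refine IsOpenEmbedding.isOpenMap ⟨Real.arctan_strictMono.isEmbedding_of_ordConnected ?_, ?_⟩
    · rw [Real.range_arctan]; exact ordConnected_Ioo
    · rw [Real.range_arctan]; exact isOpen_Ioo
  let a : ℝ ≃ₜ ℝ := (Homeomorph.subRight z.re).trans (Homeomorph.mulRight₀ z.im⁻¹ (inv_ne_zero hz))
  let b : ℝ ≃ₜ ℝ := (Homeomorph.mulRight₀ π⁻¹ (inv_ne_zero Real.pi_ne_zero)).trans
    (Homeomorph.subLeft (1 / 2))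
  have h2 := b.isOpenMap.comp (h1.comp a.isOpenMap)
  exact h2

lemma isOpenEmbedding_cayleyAngle (hz : z.im ≠ 0) :
    IsOpenEmbedding fun x => (cayleyAngle z x : UnitAddCircle) := by
  refine .of_continuous_injective_isOpenMap
    ((AddCircle.continuous_mk' 1).comp (continuous_cayleyAngle hz)) (fun x y h => ?_)
    ((QuotientAddGroup.isOpenMap_coe).comp (isOpenMap_cayleyAngle hz))
  refine cayleyAngle_injective hz ?_
  refine (AddCircle.coe_eq_coe_iff_of_mem_Ico (p := (1 : ℝ)) (a := 0) ?_ ?_).1 h <;>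
  · rw [zero_add]
    exact Ioo_subset_Ico_self (cayleyAngle_mem_Ioo z _)

lemma fourier_one_cayleyAngle (hz : z.im ≠ 0) (x : ℝ) :
    fourier 1 (cayleyAngle z x : UnitAddCircle) = 1 + (z - (starRingEnd ℂ) z) * cauchy z x := by
  set t := (x - z.re) / z.im with ht
  have hpi : (π : ℂ) ≠ 0 := by exact_mod_cast Real.pi_ne_zero
  have h1 : 2 * π * I * (1 : ℤ) * (cayleyAngle z x : ℂ) / (1 : ℝ)
      = π * I + (((-Real.arctan t : ℝ) : ℂ) * I + ((-Real.arctan t : ℝ) : ℂ) * I) := by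
    rw [cayleyAngle, ← ht]
    push_cast
    field_simp
    ring
  rw [fourier_coe_apply, h1, Complex.exp_add, Complex.exp_pi_mul_I, Complex.exp_add,
    Complex.exp_mul_I, ← Complex.ofReal_cos, ← Complex.ofReal_sin, Real.cos_neg, Real.sin_neg,
    Real.cos_arctan, Real.sin_arctan]
  have hs : (√(1 + t ^ 2) : ℂ) ^ 2 = 1 + (t : ℂ) ^ 2 := by
    rw [← Complex.ofReal_pow, Real.sq_sqrt (by positivity)]
    push_cast
    rfl
  have hs0 : (√(1 + t ^ 2) : ℂ) ≠ 0 := by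
    rw [Complex.ofReal_ne_zero]
    positivity
  have hx : (x : ℂ) - z = z.im * (t - I) := by
    have hzi : (z.im : ℂ) ≠ 0 := by exact_mod_cast hz
    rw [ht]
    push_cast
    rw [mul_sub, mul_div_cancel₀ _ hzi]
    nth_rewrite 1 [← Complex.re_add_im z]
    ring
  have hzi : (z.im : ℂ) ≠ 0 := by exact_mod_cast hz
  have h3 := ofReal_sub_ne_zero hz x
  have h4 : (t : ℂ) - I ≠ 0 := by
    intro h
    rw [h, mul_zero] at hx
    exact h3 hx
  have h5 : 1 + (t : ℂ) ^ 2 ≠ 0 := by rw [← hs]; exact pow_ne_zero _ hs0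
  rw [cauchy, hx, Complex.sub_conj]
  push_cast
  have h6 : (1 / (√(1 + t ^ 2) : ℂ) + -(t / (√(1 + t ^ 2) : ℂ)) * I) *
      (1 / (√(1 + t ^ 2) : ℂ) + -(t / (√(1 + t ^ 2) : ℂ)) * I) = (1 - t * I) ^ 2 / (1 + t ^ 2) := by
    rw [← hs]
    field_simp
    ring
  rw [h6]
  field_simp
  ring_nf
  simp only [Complex.I_sq, show I ^ 3 = -I by rw [pow_succ, Complex.I_sq]; ring]
  ring

end cayleyAngle

namespace SpectralMeasure

variable {H : SelfAdjointOperator 𝓗}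

lemma bddMeas_comp_cayleyAngle {z : ℂ} (hz : z.im ≠ 0) (g : C(UnitAddCircle, ℂ)) :
    BddMeas fun x => g (cayleyAngle z x : UnitAddCircle) :=
  .of_continuous (g.continuous.comp (isOpenEmbedding_cayleyAngle hz).continuous)
    fun _ => g.norm_coe_le_norm _

/-- The functional calculus in the Cayley coordinate. -/
def circleCalc (E : SpectralMeasure H) {z : ℂ} (hz : z.im ≠ 0) :
    C(UnitAddCircle, ℂ) →⋆ₐ[ℂ] (𝓗 →L[ℂ] 𝓗) where
  toFun g := E.fc fun x => g (cayleyAngle z x : UnitAddCircle)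
  map_one' := (E.fc_const 1).trans (one_smul _ _)
  map_mul' g g' := E.fc_mul (bddMeas_comp_cayleyAngle hz g) (bddMeas_comp_cayleyAngle hz g')
  map_zero' := (E.fc_const 0).trans (zero_smul _ _)
  map_add' g g' := E.fc_add (bddMeas_comp_cayleyAngle hz g) (bddMeas_comp_cayleyAngle hz g')
  commutes' c := E.fc_const c
  map_star' g := (E.adjoint_fc (bddMeas_comp_cayleyAngle hz g)).symm

lemma circleCalc_eq_unitCalc (E : SpectralMeasure H) {z : ℂ} (hz : z.im ≠ 0)
    {u : unitary (𝓗 →L[ℂ] 𝓗)}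
    (hu : (u : 𝓗 →L[ℂ] 𝓗) = 1 + (z - (starRingEnd ℂ) z) • H.resolvent z)
    (g : C(UnitAddCircle, ℂ)) : E.circleCalc hz g = unitCalc u g := by
  have h1 : E.circleCalc hz (fourier 1) = unitCalc u (fourier 1) := by
    rw [unitCalc_fourier_one, hu, E.resolvent_eq_fc hz, ← E.fc_const_mul _ (bddMeas_cauchy hz),
      ← one_smul ℂ (1 : 𝓗 →L[ℂ] 𝓗), ← E.fc_const, ← E.fc_add (BddMeas.const 1)
        ((BddMeas.const _).mul (bddMeas_cauchy hz))]
    exact congrArg E.fc (funext (fourier_one_cayleyAngle hz))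
  have h2 (n : ℕ) : E.circleCalc hz (fourier (n : ℤ)) = unitCalc u (fourier (n : ℤ)) := by
    rw [fourier_natCast, map_pow, map_pow, h1]
  have h3 (n : ℤ) : E.circleCalc hz (fourier n) = unitCalc u (fourier n) := by
    obtain ⟨k, rfl | rfl⟩ := n.eq_nat_or_neg
    · exact h2 k
    · have : (fourier (-(k : ℤ)) : C(UnitAddCircle, ℂ)) = star (fourier (k : ℤ)) := by
        ext x
        exact fourier_neg
      rw [this, map_star, map_star, h2]
  have hc1 : Continuous (E.circleCalc hz) :=
    AddMonoidHomClass.continuous_of_bound (E.circleCalc hz) 1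
      fun g => (NonUnitalStarAlgHom.norm_apply_le _ g).trans_eq (one_mul _).symm
  have hc2 : Continuous (unitCalc u) :=
    AddMonoidHomClass.continuous_of_bound (unitCalc u) 1
      fun g => (norm_unitCalc_le u g).trans_eq (one_mul _).symm
  have := ContinuousLinearMap.ext_on (s := range (@fourier 1))
    (f := ⟨(E.circleCalc hz).toAlgHom.toLinearMap, hc1⟩)
    (g := ⟨(unitCalc u).toAlgHom.toLinearMap, hc2⟩)
    (Submodule.dense_iff_topologicalClosure_eq_top.2 span_fourier_closure_eq_top)
    (by rintro _ ⟨n, rfl⟩; exact h3 n)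
  exact DFunLike.congr_fun this g

end SpectralMeasure

lemma continuous_extend_zero_of_isOpenEmbedding {X Y β : Type*} [TopologicalSpace X]
    [TopologicalSpace Y] [T2Space Y] [TopologicalSpace β] [Zero β] {κ : X → Y}
    (hκ : IsOpenEmbedding κ) {f : X → β} (hf : Continuous f) (hc : HasCompactSupport f) :
    Continuous (Function.extend κ f 0) := by
  refine continuous_of_tsupport fun y hy => ?_
  obtain ⟨x, -, rfl⟩ := hc.tsupport_extend_zero_subset hκ.continuous hy
  rw [← hκ.continuousAt_iff, Function.extend_comp hκ.injective]
  exact hf.continuousAt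

/-- The function `φ(x) |x - z|²`. -/
def weighted (z : ℂ) (φ : ℝ → ℝ) (x : ℝ) : ℝ := φ x * Complex.normSq (x - z)

section weighted

variable {z : ℂ} {φ : ℝ → ℝ}

lemma continuous_normSq_ofReal_sub (z : ℂ) : Continuous fun x : ℝ => Complex.normSq (x - z) := by
  have := Complex.continuous_normSq
  fun_prop

lemma continuous_weighted (hφ : Continuous φ) : Continuous (weighted z φ) :=
  hφ.mul (continuous_normSq_ofReal_sub z)

lemma hasCompactSupport_weighted (hc : HasCompactSupport φ) : HasCompactSupport (weighted z φ) :=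
  hc.mul_right

/-- The function `φ(x) |x - z|²` in the Cayley coordinate. -/
def circleWeighted (hz : z.im ≠ 0) (hφ : Continuous φ) (hc : HasCompactSupport φ) :
    C(UnitAddCircle, ℝ) :=
  ⟨Function.extend (fun x => (cayleyAngle z x : UnitAddCircle)) (weighted z φ) 0,
    continuous_extend_zero_of_isOpenEmbedding (isOpenEmbedding_cayleyAngle hz)
      (continuous_weighted hφ) (hasCompactSupport_weighted hc)⟩

lemma circleWeighted_cayleyAngle (hz : z.im ≠ 0) (hφ : Continuous φ) (hc : HasCompactSupport φ)
    (x : ℝ) : circleWeighted hz hφ hc (cayleyAngle z x : UnitAddCircle) = weighted z φ x :=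
  (isOpenEmbedding_cayleyAngle hz).injective.extend_apply _ _ _

end weighted

namespace SpectralMeasure

variable {H : SelfAdjointOperator 𝓗} {ι : Type*} {e : ι → 𝓗} {lam : ι → ℝ}

lemma mul_trace_eq_traceForm (E : SpectralMeasure H) {z : ℂ} (hz : z.im ≠ 0) {φ : ℝ → ℝ}
    (hφ : Continuous φ) (hc : HasCompactSupport φ) (he : Orthonormal ℂ e) (hl : Summable lam)
    {V A : 𝓗 →L[ℂ] 𝓗} {c : ℂ}
    (h : c • (star (H.resolvent z) * V * H.resolvent z) = A * diagOp e lam * star A) :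
    c * trace (E.proj (tsupport φ) ∘L (V ∘L E.fcR φ))
      = traceForm e lam (star A * E.fc (fun x => (weighted z φ x : ℂ)) * A) := by
  have hz' : ((starRingEnd ℂ) z).im ≠ 0 := by simpa using hz
  have hK : MeasurableSet (tsupport φ) := (isClosed_tsupport φ).measurableSet
  let a : ℝ → ℂ := (tsupport φ).indicator fun x => (x : ℂ) - (starRingEnd ℂ) z
  let b : ℝ → ℂ := fun x => ((x : ℂ) - z) * φ x
  have ha : BddMeas a := by
    have hcont : Continuous fun x : ℝ => (x : ℂ) - (starRingEnd ℂ) z := by fun_prop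
    obtain ⟨C, hC⟩ := hc.isCompact.exists_bound_of_continuousOn hcont.continuousOn
    refine ⟨hcont.measurable.indicator hK, max C 0, fun x => ?_⟩
    by_cases hx : x ∈ tsupport φ
    · simp only [a, indicator_of_mem hx]
      exact (hC x hx).trans (le_max_left _ _)
    · simp only [a, indicator_of_notMem hx, norm_zero]
      exact le_max_right _ _
  have hb : BddMeas b := by
    have hcont : Continuous b := by fun_prop
    have hcb : HasCompactSupport b :=
      (hc.comp_left (g := ((↑) : ℝ → ℂ)) Complex.ofReal_zero).mul_left
    obtain ⟨C, hC⟩ := hcb.exists_bound_of_continuous hcont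
    exact .of_continuous hcont hC
  have h1 : E.proj (tsupport φ) = E.fc a * star (H.resolvent z) := by
    rw [E.star_resolvent hz, E.resolvent_eq_fc hz', ← E.fc_mul ha (bddMeas_cauchy hz'),
      ← one_smul ℂ (E.proj _), ← E.fc_indicator_const 1 hK]
    congr 1
    funext x
    by_cases hx : x ∈ tsupport φ
    · simp only [a, indicator_of_mem hx, cauchy]
      rw [mul_inv_cancel₀ (ofReal_sub_ne_zero hz' x)]
    · simp only [a, indicator_of_notMem hx, zero_mul]
  have h2 : E.fcR φ = H.resolvent z * E.fc b := by
    rw [E.resolvent_eq_fc hz, ← E.fc_mul (bddMeas_cauchy hz) hb, fcR]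
    congr 1
    funext x
    rw [cauchy, inv_mul_cancel_left₀ (ofReal_sub_ne_zero hz x)]
  have h3 : E.fc b * E.fc a = E.fc fun x => (weighted z φ x : ℂ) := by
    rw [← E.fc_mul hb ha]
    congr 1
    funext x
    by_cases hx : x ∈ tsupport φ
    · simp only [a, b, indicator_of_mem hx, weighted]
      have : (x : ℂ) - (starRingEnd ℂ) z = (starRingEnd ℂ) ((x : ℂ) - z) := by simp
      rw [this]
      push_cast
      rw [← Complex.mul_conj]
      ring
    · simp only [a, indicator_of_notMem hx, weighted, image_eq_zero_of_notMem_tsupport hx, zero_mul,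
        mul_zero, Complex.ofReal_zero]
  have h4 : c • (E.proj (tsupport φ) ∘L (V ∘L E.fcR φ))
      = E.fc a * A * diagOp e lam * (star A * E.fc b) := by
    change c • (E.proj (tsupport φ) * (V * E.fcR φ)) = _
    rw [h1, h2]
    calc _ = E.fc a * (c • (star (H.resolvent z) * V * H.resolvent z)) * E.fc b := by
          simp only [mul_smul_comm, smul_mul_assoc, mul_assoc]
      _ = _ := by rw [h]; simp only [mul_assoc]
  obtain ⟨β, hβ⟩ := (exists_hilbertBasis ℂ 𝓗).choose_spec
  have h5 := hasSum_inner_mul_diagOp_mul β he hl (E.fc a * A) (star A * E.fc b)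
  rw [← h4, hβ] at h5
  have h6 : star A * E.fc b * (E.fc a * A)
      = star A * E.fc (fun x => (weighted z φ x : ℂ)) * A := by
    rw [← h3]
    simp only [mul_assoc]
  rw [h6] at h5
  rw [trace, ← tsum_mul_left, ← h5.tsum_eq]
  refine tsum_congr fun i => ?_
  rw [smul_apply, inner_smul_right]

end SpectralMeasure

namespace AffineSetting

variable (𝒜 : AffineSetting 𝓗) {ι : Type*} {e : ι → 𝓗} {lam : ι → ℝ}

lemma PhiMeas_eq_density (E : ∀ V : 𝓗 →L[ℂ] 𝓗, SpectralMeasure (𝒜.opOf V))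
    {W₀ W₁ : 𝓗 →L[ℂ] 𝓗} (h₀ : W₀ ∈ 𝒜.A0) (h₁ : W₁ ∈ 𝒜.A0) {z : ℂ} (hz : z.im ≠ 0)
    (he : Orthonormal ℂ e) (hl : Summable lam)
    (hD : (𝒜.resolventPath E h₀ h₁ hz).D = diagOp e lam) {φ : ℝ → ℝ} (hφ : Continuous φ)
    (hc : HasCompactSupport φ) (s : ℝ) :
    -2 * z.im * PhiMeas (E (W₀ + (s : ℂ) • (W₁ - W₀))) (W₁ - W₀) φ
      = (((𝒜.resolventPath E h₀ h₁ hz).toUnitaryPath hD).density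
          (realToComplex (circleWeighted hz hφ hc)) s).re := by
  set r := 𝒜.resolventPath E h₀ h₁ hz
  have h : ((-2 * z.im : ℝ) : ℂ) • (star (r.R s) * (W₁ - W₀) * r.R s)
      = r.A s * diagOp e lam * star (r.A s) := by
    rw [← hD, ResolventPath.D, ← r.R_zero_mul_star_A s, star_mul, star_star]
    simp only [mul_smul_comm, smul_mul_assoc, mul_assoc]
  have h2 := (E (W₀ + (s : ℂ) • (W₁ - W₀))).mul_trace_eq_traceForm hz hφ hc he hl h
  have h3 : unitCalc (r.unit s) (realToComplex (circleWeighted hz hφ hc))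
      = (E (W₀ + (s : ℂ) • (W₁ - W₀))).fc (fun x => (weighted z φ x : ℂ)) := by
    rw [← (E (W₀ + (s : ℂ) • (W₁ - W₀))).circleCalc_eq_unitCalc hz (r.coe_unit s)]
    refine congrArg (E (W₀ + (s : ℂ) • (W₁ - W₀))).fc (funext fun x => ?_)
    exact congrArg ((↑) : ℝ → ℂ) (circleWeighted_cayleyAngle hz hφ hc x)
  rw [PhiMeas, ← Complex.re_ofReal_mul, h2, UnitaryPath.density, ← h3]
  rfl

end AffineSetting

section RadonNikodym

variable {X : Type*} [MeasurableSpace X]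

lemma exists_measure_of_nonneg [TopologicalSpace X] [T2Space X] [CompactSpace X] [BorelSpace X]
    (L : C(X, ℝ) →ₗ[ℝ] ℝ) (hL : ∀ g : C(X, ℝ), (∀ x, 0 ≤ g x) → 0 ≤ L g) :
    ∃ μ : Measure X, IsFiniteMeasure μ ∧ ∀ g : C(X, ℝ), L g = ∫ x, g x ∂μ := by
  let Λ : CompactlySupportedContinuousMap X ℝ →ₚ[ℝ] ℝ :=
    { toFun := fun f => L f.toContinuousMap
      map_add' := fun f g => L.map_add f.toContinuousMap g.toContinuousMap
      map_smul' := fun c f => L.map_smul c f.toContinuousMap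
      monotone' := fun f g hfg => by
        have := hL (g.toContinuousMap - f.toContinuousMap) fun x => sub_nonneg.2 (hfg x)
        rw [map_sub] at this
        exact sub_nonneg.1 this }
  refine ⟨RealRMK.rieszMeasure Λ, inferInstance, fun g => ?_⟩
  exact (RealRMK.integral_rieszMeasure Λ
    (CompactlySupportedContinuousMap.continuousMapEquiv g)).symm

lemma singularPart_eq_of_forall_null {μ ν m : Measure X} [IsFiniteMeasure μ] [IsFiniteMeasure ν]
    [IsFiniteMeasure m] (h : ∀ s, MeasurableSet s → m s = 0 → μ s = ν s) :
    μ.singularPart m = ν.singularPart m := by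
  obtain ⟨N, hN, hμN, hmN⟩ := μ.mutuallySingular_singularPart m
  obtain ⟨N', hN', hνN', hmN'⟩ := ν.mutuallySingular_singularPart m
  have key : ∀ (ρ : Measure X) [IsFiniteMeasure ρ], ρ.singularPart m (N ∩ N') = 0 →
      ∀ s, MeasurableSet s → ρ.singularPart m s = ρ (s ∩ (N ∩ N')ᶜ) := by
    intro ρ _ hρ s hs
    have h1 : m (s ∩ (N ∩ N')ᶜ) = 0 := by
      refine measure_mono_null inter_subset_right ?_
      rw [compl_inter]
      exact measure_union_null hmN hmN'
    have h2 : ρ (s ∩ (N ∩ N')ᶜ) = ρ.singularPart m (s ∩ (N ∩ N')ᶜ) := by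
      nth_rewrite 1 [ρ.haveLebesgueDecomposition_add m]
      rw [Measure.add_apply, withDensity_absolutelyContinuous _ _ h1, add_zero]
    rw [h2, measure_inter_conull]
    rwa [compl_compl]
  ext s hs
  rw [key μ (measure_mono_null inter_subset_left hμN) s hs,
    key ν (measure_mono_null inter_subset_right hνN') s hs]
  refine h _ (hs.inter (hN.inter hN').compl) ?_
  refine measure_mono_null inter_subset_right ?_
  rw [compl_inter]
  exact measure_union_null hmN hmN'

lemma measure_eq_of_integral_sub_le [PseudoMetricSpace X] [CompactSpace X] [BorelSpace X]
    {μ ν m : Measure X} [IsFiniteMeasure μ] [IsFiniteMeasure ν] [IsFiniteMeasure m]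
    (h : ∀ ε : ℝ, 0 < ε → ∃ C : ℝ, ∀ g : C(X, ℝ),
      |(∫ x, g x ∂μ) - ∫ x, g x ∂ν| ≤ C * (∫ x, |g x| ∂m) + ε * ‖g‖)
    {s : Set X} (hs : MeasurableSet s) (hms : m s = 0) : μ s = ν s := by
  have hclosed : ∀ F : Set X, IsClosed F → m F = 0 → μ F = ν F := by
    intro F hF hmF
    let δ : ℕ → ℝ := fun n => 1 / ((n : ℝ) + 1)
    have hδ : ∀ n, 0 < δ n := fun n => Nat.one_div_pos_of_nat
    have hδ0 : Tendsto δ atTop (𝓝 0) := tendsto_one_div_add_atTop_nhds_zero_nat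
    let g : ℕ → C(X, ℝ) := fun n => ⟨fun x => (thickenedIndicator (hδ n) F x : ℝ), by fun_prop⟩
    have hlim : ∀ (ρ : Measure X) [IsFiniteMeasure ρ],
        Tendsto (fun n => ∫ x, g n x ∂ρ) atTop (𝓝 (ρ.real F)) := fun ρ _ =>
      tendsto_integral_thickenedIndicator_of_isClosed ρ hF hδ hδ0
    have hg : ∀ n x, |g n x| = g n x := fun n x => abs_of_nonneg (NNReal.coe_nonneg _)
    have hg1 : ∀ n, ‖g n‖ ≤ 1 := fun n =>
      (ContinuousMap.norm_le _ zero_le_one).2 fun x => by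
        rw [Real.norm_eq_abs, hg]
        exact_mod_cast thickenedIndicator_le_one (hδ n) F x
    have hle : |μ.real F - ν.real F| ≤ 0 := by
      refine le_of_forall_pos_le_add fun ε hε => ?_
      obtain ⟨C, hC⟩ := h ε hε
      have h1 := ((hlim μ).sub (hlim ν)).abs
      have h2 := ((hlim m).const_mul C).add_const ε
      rw [Measure.real, hmF, ENNReal.toReal_zero, mul_zero] at h2
      refine le_of_tendsto_of_tendsto' h1 h2 fun n => (hC (g n)).trans ?_
      simp only [hg]
      gcongr
      exact mul_le_of_le_one_right hε.le (hg1 n)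
    have := sub_eq_zero.1 (abs_nonpos_iff.1 hle)
    exact (ENNReal.toReal_eq_toReal_iff' (measure_ne_top _ _) (measure_ne_top _ _)).1 this
  rw [hs.measure_eq_iSup_isClosed_of_ne_top (measure_ne_top _ _),
    hs.measure_eq_iSup_isClosed_of_ne_top (measure_ne_top _ _)]
  exact iSup_congr fun F => iSup_congr fun hFs => iSup_congr fun hF =>
    hclosed F hF (measure_mono_null hFs hms)

lemma exists_density_of_integral_sub_le [PseudoMetricSpace X] [CompactSpace X] [BorelSpace X]
    {μ ν m : Measure X} [IsFiniteMeasure μ] [IsFiniteMeasure ν] [IsFiniteMeasure m]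
    (h : ∀ ε : ℝ, 0 < ε → ∃ C : ℝ, ∀ g : C(X, ℝ),
      |(∫ x, g x ∂μ) - ∫ x, g x ∂ν| ≤ C * (∫ x, |g x| ∂m) + ε * ‖g‖) :
    ∃ f : X → ℝ, Integrable f m ∧
      ∀ g : C(X, ℝ), (∫ x, g x ∂μ) - ∫ x, g x ∂ν = ∫ x, g x * f x ∂m := by
  have hs : μ.singularPart m = ν.singularPart m :=
    singularPart_eq_of_forall_null fun s hs hms => measure_eq_of_integral_sub_le h hs hms
  have hInt : ∀ (ρ : Measure X) [IsFiniteMeasure ρ] (g : C(X, ℝ)), Integrable g ρ := fun ρ _ g =>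
    .of_bound g.continuous.aestronglyMeasurable ‖g‖ (.of_forall g.norm_coe_le_norm)
  have hmul : ∀ (ρ : Measure X) [IsFiniteMeasure ρ] (g : C(X, ℝ)),
      Integrable (fun x => g x * (ρ.rnDeriv m x).toReal) m := fun ρ _ g =>
    Measure.integrable_toReal_rnDeriv.bdd_mul g.continuous.aestronglyMeasurable
      (.of_forall g.norm_coe_le_norm)
  have key : ∀ (ρ : Measure X) [IsFiniteMeasure ρ] (g : C(X, ℝ)),
      ∫ x, g x ∂ρ = (∫ x, g x ∂(ρ.singularPart m)) + ∫ x, g x * (ρ.rnDeriv m x).toReal ∂m := by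
    intro ρ _ g
    nth_rewrite 1 [ρ.haveLebesgueDecomposition_add m]
    rw [integral_add_measure (hInt _ g) (hInt _ g), integral_withDensity_eq_integral_toReal_smul
      (ρ.measurable_rnDeriv m) (ρ.rnDeriv_lt_top m)]
    simp only [smul_eq_mul, mul_comm]
  refine ⟨fun x => (μ.rnDeriv m x).toReal - (ν.rnDeriv m x).toReal,
    Measure.integrable_toReal_rnDeriv.sub Measure.integrable_toReal_rnDeriv, fun g => ?_⟩
  simp only [mul_sub]
  rw [key μ g, key ν g, hs, add_sub_add_left_eq_sub, integral_sub (hmul μ g) (hmul ν g)]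

end RadonNikodym

namespace UnitaryPath

variable {ι : Type*} {e : ι → 𝓗} {lam : ι → ℝ} (p : UnitaryPath e lam)

lemma continuous_traceForm_re (mu : ι → ℝ) (g : C(UnitAddCircle, ℝ)) : Continuous fun s =>
    (traceForm e mu (star (p.A s) * unitCalc (p.u s) (realToComplex g) * p.A s)).re := by
  have h1 := continuous_unitCalc p.continuous_u (realToComplex g)
  have h2 := p.continuous_A
  exact Complex.continuous_re.comp
    ((traceForm e mu).continuous.comp ((h2.star.mul h1).mul h2))

/-- The real part of the shift functional over `[0, 1]`, with the weights of the trace form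
replaced by `mu`. -/
def realShift (mu : ι → ℝ) : C(UnitAddCircle, ℝ) →ₗ[ℝ] ℝ where
  toFun g := ∫ s in (0:ℝ)..1,
    (traceForm e mu (star (p.A s) * unitCalc (p.u s) (realToComplex g) * p.A s)).re
  map_add' g g' := by
    rw [← intervalIntegral.integral_add
      ((continuous_traceForm_re p mu g).intervalIntegrable _ _)
      ((continuous_traceForm_re p mu g').intervalIntegrable _ _)]
    have h : realToComplex (g + g') = realToComplex g + realToComplex g' := by
      ext y
      exact Complex.ofReal_add _ _
    simp only [h, map_add, mul_add, add_mul, Complex.add_re]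
  map_smul' c g := by
    rw [RingHom.id_apply, ← intervalIntegral.integral_smul]
    have h : realToComplex (c • g) = (c : ℂ) • realToComplex g := by
      ext y
      exact Complex.ofReal_mul _ _
    simp only [h, map_smul, mul_smul_comm, smul_mul_assoc, smul_eq_mul, Complex.re_ofReal_mul]

lemma realShift_nonneg (he : Orthonormal ℂ e) {mu : ι → ℝ} (hs : Summable mu)
    (h0 : ∀ j, 0 ≤ mu j) {g : C(UnitAddCircle, ℝ)} (hg : ∀ y, 0 ≤ g y) :
    0 ≤ p.realShift mu g := by
  refine intervalIntegral.integral_nonneg zero_le_one fun s _ => ?_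
  have h := Complex.hasSum_re (hasSum_traceForm he hs
    (star (p.A s) * unitCalc (p.u s) (realToComplex g) * p.A s))
  refine h.nonneg fun j => ?_
  rw [Complex.re_ofReal_mul, mul_apply_eq_comp, mul_apply_eq_comp,
    ContinuousLinearMap.star_eq_adjoint, ContinuousLinearMap.adjoint_inner_right]
  exact mul_nonneg (h0 j) (re_inner_unitCalc_nonneg _ _ hg)

lemma realShift_sub (he : Orthonormal ℂ e) {mu mu' : ι → ℝ} (hs : Summable mu)
    (hs' : Summable mu') (h : ∀ j, lam j = mu j - mu' j) (g : C(UnitAddCircle, ℝ)) :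
    p.realShift mu g - p.realShift mu' g = (p.shift 0 1 (realToComplex g)).re := by
  have hl : Summable lam := (hs.sub hs').congr fun j => (h j).symm
  have hre : (p.shift 0 1 (realToComplex g)).re
      = ∫ s in (0:ℝ)..1, (p.density (realToComplex g) s).re :=
    (Complex.reCLM.intervalIntegral_comp_comm
      ((p.continuous_density (realToComplex g)).intervalIntegrable 0 1)).symm
  rw [hre]
  refine (intervalIntegral.integral_sub
      ((continuous_traceForm_re p mu g).intervalIntegrable _ _)
      ((continuous_traceForm_re p mu' g).intervalIntegrable _ _)).symm.trans ?_
  refine intervalIntegral.integral_congr fun s _ => ?_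
  have hu := (hasSum_traceForm he hl
      (star (p.A s) * unitCalc (p.u s) (realToComplex g) * p.A s)).unique
    (((hasSum_traceForm he hs _).sub (hasSum_traceForm he hs' _)).congr_fun fun j => by
      rw [h j, Complex.ofReal_sub, sub_mul])
  simp only [density, hu, Complex.sub_re]

/-- The shift functional of a path with trace class `D` has an integrable density. -/
theorem exists_integrable_density (he : Orthonormal ℂ e) (hl : Summable lam)
    (hD : IsTraceClass (diagOp e lam)) :
    ∃ f : UnitAddCircle → ℝ, Integrable f AddCircle.haarAddCircle ∧
      ∀ g : C(UnitAddCircle, ℝ), (p.shift 0 1 (realToComplex g)).re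
        = ∫ x, g x * f x ∂AddCircle.haarAddCircle := by
  have hs : Summable fun j => max (lam j) 0 :=
    Summable.of_nonneg_of_le (fun _ => le_max_right _ _)
      (fun j => max_le (le_abs_self _) (abs_nonneg _)) hl.abs
  have hs' : Summable fun j => max (-lam j) 0 :=
    Summable.of_nonneg_of_le (fun _ => le_max_right _ _)
      (fun j => max_le (neg_le_abs _) (abs_nonneg _)) hl.abs
  have hsub := p.realShift_sub he hs hs' fun j => (max_zero_sub_eq_self (lam j)).symm
  obtain ⟨μ, _, hμ⟩ := exists_measure_of_nonneg (p.realShift fun j => max (lam j) 0)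
    fun g hg => p.realShift_nonneg he hs (fun _ => le_max_right _ _) hg
  obtain ⟨ν, _, hν⟩ := exists_measure_of_nonneg (p.realShift fun j => max (-lam j) 0)
    fun g hg => p.realShift_nonneg he hs' (fun _ => le_max_right _ _) hg
  simp only [hμ, hν] at hsub
  obtain ⟨f, hf, hfg⟩ := exists_density_of_integral_sub_le (μ := μ) (ν := ν)
    (m := AddCircle.haarAddCircle (T := (1:ℝ))) fun ε hε => by
      obtain ⟨C, hC⟩ := p.exists_norm_shift_le_integral he hl hD 0 1 hε
      refine ⟨C, fun g => ?_⟩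
      rw [hsub]
      have hn : ‖realToComplex g‖ ≤ ‖g‖ :=
        (ContinuousMap.norm_le _ (norm_nonneg _)).2 fun y =>
          (Complex.norm_real _).trans_le (g.norm_coe_le_norm y)
      have hi : (∫ x, ‖realToComplex g x‖ ∂AddCircle.haarAddCircle)
          = ∫ x, |g x| ∂AddCircle.haarAddCircle :=
        integral_congr_ae (.of_forall fun x => Complex.norm_real _)
      refine ((Complex.abs_re_le_norm _).trans (hC _)).trans ?_
      rw [hi]
      gcongr
  exact ⟨f, hf, fun g => (hsub g).symm.trans (hfg g)⟩

end UnitaryPath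

section transfer

variable {z : ℂ}

lemma haarAddCircle_eq_volume :
    (AddCircle.haarAddCircle : Measure UnitAddCircle) = volume := by
  rw [AddCircle.volume_eq_smul_haarAddCircle, ENNReal.ofReal_one, one_smul]

lemma integral_haarAddCircle_eq (hz : z.im ≠ 0) (F : UnitAddCircle → ℝ) :
    ∫ y, F y ∂AddCircle.haarAddCircle
      = ∫ x : ℝ, |-(z.im / π) / Complex.normSq (x - z)| * F (cayleyAngle z x) := by
  have h := integral_image_eq_integral_abs_deriv_smul MeasurableSet.univ
    (fun x _ => (hasDerivAt_cayleyAngle hz x).hasDerivWithinAt)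
    (cayleyAngle_injective hz).injOn fun t : ℝ => F t
  rw [image_cayleyAngle hz, Measure.restrict_univ, ← integral_Ioc_eq_integral_Ioo] at h
  have h' := UnitAddCircle.integral_preimage 0 F
  rw [zero_add] at h'
  rw [haarAddCircle_eq_volume, ← h', h]
  simp only [smul_eq_mul]

lemma integrable_comp_cayleyAngle (hz : z.im ≠ 0) {f : UnitAddCircle → ℝ}
    (hf : Integrable f AddCircle.haarAddCircle) :
    Integrable fun x : ℝ => |-(z.im / π) / Complex.normSq (x - z)| * f (cayleyAngle z x) := by
  rw [haarAddCircle_eq_volume] at hf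
  have h1 : IntegrableOn (fun t : ℝ => f t) (Ioc 0 (0 + 1)) :=
    (UnitAddCircle.measurePreserving_mk 0).integrable_comp_of_integrable hf
  rw [zero_add] at h1
  have h2 := h1.mono_set Ioo_subset_Ioc_self
  rw [← image_cayleyAngle hz, integrableOn_image_iff_integrableOn_abs_deriv_smul MeasurableSet.univ
    (fun x _ => (hasDerivAt_cayleyAngle hz x).hasDerivWithinAt)
    (cayleyAngle_injective hz).injOn, integrableOn_univ] at h2
  exact h2

lemma normSq_ofReal_sub_pos (hz : z.im ≠ 0) (x : ℝ) : 0 < Complex.normSq (x - z) := by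
  refine Complex.normSq_pos.2 fun h => hz ?_
  simpa using congr_arg Complex.im h

lemma abs_deriv_cayleyAngle_mul (hz : z.im ≠ 0) (x : ℝ) :
    |-(z.im / π) / Complex.normSq (x - z)| * Complex.normSq (x - z) = |z.im| / π := by
  have h := normSq_ofReal_sub_pos hz x
  rw [abs_div, abs_neg, abs_div, abs_of_pos Real.pi_pos, abs_of_pos h, div_mul_cancel₀ _ h.ne']

lemma locallyIntegrable_comp_cayleyAngle (hz : z.im ≠ 0) {f : UnitAddCircle → ℝ}
    (hf : Integrable f AddCircle.haarAddCircle) :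
    LocallyIntegrable fun x : ℝ => |z.im| / π * f (cayleyAngle z x) := by
  refine locallyIntegrable_iff.2 fun K hK => ?_
  refine ((integrable_comp_cayleyAngle hz hf).integrableOn.continuousOn_mul
    (continuous_normSq_ofReal_sub z).continuousOn hK).congr_fun (fun x _ => ?_) hK.measurableSet
  simp only
  rw [← abs_deriv_cayleyAngle_mul hz x]
  ring

lemma integral_circleWeighted_mul (hz : z.im ≠ 0) {φ : ℝ → ℝ} (hφ : Continuous φ)
    (hc : HasCompactSupport φ) (f : UnitAddCircle → ℝ) :
    ∫ y, circleWeighted hz hφ hc y * f y ∂AddCircle.haarAddCircle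
      = ∫ x : ℝ, φ x * (|z.im| / π * f (cayleyAngle z x)) := by
  rw [integral_haarAddCircle_eq hz]
  refine integral_congr_ae (.of_forall fun x => ?_)
  simp only [circleWeighted_cayleyAngle, weighted]
  rw [← abs_deriv_cayleyAngle_mul hz x]
  ring

end transfer

/-- In the affine setting `𝒜 = H₀ + 𝒜₀`, for any `H₀, H₁ ∈ 𝒜` the
spectral shift measure `ξ(·; H₁, H₀)` of the Birman–Solomyak formula is absolutely
continuous with respect to Lebesgue measure. -/
theorem spectral_shift_measure_absolutely_continuous
    (𝓗 : Type) [NormedAddCommGroup 𝓗] [InnerProductSpace ℂ 𝓗] [CompleteSpace 𝓗]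
    (𝒜 : AffineSetting 𝓗)
    (E : ∀ V : 𝓗 →L[ℂ] 𝓗, SpectralMeasure (𝒜.opOf V))
    (W₀ W₁ : 𝓗 →L[ℂ] 𝓗) (hW₀ : W₀ ∈ 𝒜.A0) (hW₁ : W₁ ∈ 𝒜.A0) :
    ∃ d : ℝ → ℝ,
      MeasureTheory.LocallyIntegrable d MeasureTheory.volume ∧
      ∀ φ : ℝ → ℝ, Continuous φ → HasCompactSupport φ →
        (∫ r in (0:ℝ)..1, PhiMeas (E (W₀ + (r : ℂ) • (W₁ - W₀))) (W₁ - W₀) φ)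
          = ∫ x : ℝ, φ x * d x := by
  obtain ⟨z, hz, htc⟩ := 𝒜.comparable W₀ hW₀ W₁ hW₁
  have hT : IsTraceClass
      ((𝒜.resolventPath E hW₀ hW₁ hz).R 1 - (𝒜.resolventPath E hW₀ hW₁ hz).R 0) := by
    change IsTraceClass ((𝒜.opOf (W₀ + ((1 : ℝ) : ℂ) • (W₁ - W₀))).resolvent z
      - (𝒜.opOf (W₀ + ((0 : ℝ) : ℂ) • (W₁ - W₀))).resolvent z)
    rwa [Complex.ofReal_one, one_smul, add_sub_cancel, Complex.ofReal_zero, zero_smul, add_zero]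
  have hTD := (𝒜.resolventPath E hW₀ hW₁ hz).isTraceClass_D hT
  obtain ⟨ι, e, lam, he, hl, hD⟩ :=
    hTD.exists_eq_diagOp (𝒜.resolventPath E hW₀ hW₁ hz).isSelfAdjoint_D
  let p := (𝒜.resolventPath E hW₀ hW₁ hz).toUnitaryPath hD
  obtain ⟨f, hf, hfg⟩ := p.exists_integrable_density he hl (hD ▸ hTD)
  refine ⟨fun x => (-2 * z.im)⁻¹ * (|z.im| / π * f (cayleyAngle z x)),
    (locallyIntegrable_comp_cayleyAngle hz hf).smul (-2 * z.im)⁻¹, fun φ hφ hc => ?_⟩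
  have hc0 : -2 * z.im ≠ 0 := mul_ne_zero (by norm_num) hz
  have hΦ : ∀ s : ℝ, PhiMeas (E (W₀ + (s : ℂ) • (W₁ - W₀))) (W₁ - W₀) φ
      = (-2 * z.im)⁻¹ * (p.density (realToComplex (circleWeighted hz hφ hc)) s).re := fun s => by
    rw [← 𝒜.PhiMeas_eq_density E hW₀ hW₁ hz he hl hD hφ hc s, inv_mul_cancel_left₀ hc0]
  have hre : ∫ s in (0:ℝ)..1, (p.density (realToComplex (circleWeighted hz hφ hc)) s).re
      = (p.shift 0 1 (realToComplex (circleWeighted hz hφ hc))).re :=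
    Complex.reCLM.intervalIntegral_comp_comm
      ((p.continuous_density (realToComplex (circleWeighted hz hφ hc))).intervalIntegrable 0 1)
  simp only [hΦ]
  rw [intervalIntegral.integral_const_mul, hre, hfg, integral_circleWeighted_mul,
    ← integral_const_mul]
  exact integral_congr_ae (.of_forall fun x => mul_left_comm _ _ _)

end SSF
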